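/- Let w be a cyclically reduced word with [w] ∈ 𝒢 and let r be a run of w such that ℓ(r) > ℓ(s) for every other run s of w of the same type as r. Then I(w⁺[r]) = I(w) + 1. -/

import Mathlib

open scoped Classical

abbrev SL2Z := Matrix.SpecialLinearGroup (Fin 2) ℤ

def Amat : SL2Z := ⟨!![1, 2; 0, 1], by norm_num [Matrix.det_fin_two_of]⟩
def Bmat : SL2Z := ⟨!![1, 0; -2, 1], by norm_num [Matrix.det_fin_two_of]⟩
def Cmat : SL2Z := (Amat * Bmat)⁻¹

def Gamma : Subgroup SL2Z := Subgroup.closure {Amat, Bmat}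

/-- The real entry `i j` of a matrix in `SL₂(ℤ)`. -/
def entry (g : SL2Z) (i j : Fin 2) : ℝ := ((g : Matrix (Fin 2) (Fin 2) ℤ) i j : ℤ)

/-- The Möbius action of `SL₂(ℤ)` on the circle `ℝ ∪ {∞}`. -/
noncomputable def mobius (g : SL2Z) (p : OnePoint ℝ) : OnePoint ℝ :=
  Option.rec (motive := fun _ => OnePoint ℝ)
    (if entry g 1 0 = 0 then OnePoint.infty
     else OnePoint.some (entry g 0 0 / entry g 1 0))
    (fun x => if entry g 1 0 * x + entry g 1 1 = 0 then OnePoint.infty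
      else OnePoint.some ((entry g 0 0 * x + entry g 0 1) / (entry g 1 0 * x + entry g 1 1)))
    p

/-- The fixed-point set of `g` acting on the circle `ℝ ∪ {∞}`. -/
noncomputable def fixedSet (g : SL2Z) : Set (OnePoint ℝ) := {p | mobius g p = p}

/-- `g` is hyperbolic if `|trace g| > 2`. -/
def Hyperbolic (g : SL2Z) : Prop := 2 < |Matrix.trace (g : Matrix (Fin 2) (Fin 2) ℤ)|

/-- Two two-element subsets of the circle are linked if the two points of `Q` lie in
different connected components of the complement of `P`. -/
def Linked (P Q : Set (OnePoint ℝ)) : Prop :=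
  ∃ q₁ q₂ : OnePoint ℝ, q₁ ≠ q₂ ∧ Q = {q₁, q₂} ∧
    connectedComponentIn Pᶜ q₁ ≠ connectedComponentIn Pᶜ q₂

/-- `h` contributes to the count `s(v)`: `v` and `h * v * h⁻¹` are hyperbolic with
linked fixed-point sets. -/
def GoodConj (v h : Gamma) : Prop :=
  Hyperbolic (v : SL2Z) ∧ Hyperbolic ((h * v * h⁻¹ : Gamma) : SL2Z) ∧
    Linked (fixedSet (v : SL2Z)) (fixedSet ((h * v * h⁻¹ : Gamma) : SL2Z))

/-- Twice `s(v)`: the number of double cosets `⟨v⟩ h ⟨v⟩` in `Γ` such that `v` and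
`h * v * h⁻¹` are hyperbolic with linked fixed-point sets. -/
noncomputable def sTwo (v : Gamma) : ℕ :=
  Nat.card (Quot (fun h h' : {h : Gamma // GoodConj v h} =>
    ∃ m k : ℤ, (h' : Gamma) = v ^ m * (h : Gamma) * v ^ k))

/-- `v` is not a proper power in `Γ`. -/
def NotProperPower (v : Gamma) : Prop := ¬ ∃ u : Gamma, ∃ k : ℕ, 2 ≤ k ∧ v = u ^ k

/-- The self-intersection number `I(g) = n² s(v) + n - 1`, where `g = vⁿ` with `v` not a
proper power and `n ≥ 1`, and `s(v)` is half the number of good double cosets. -/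
noncomputable def Iγ (g : Gamma) : ℤ :=
  if h : ∃ p : Gamma × ℕ, 1 ≤ p.2 ∧ NotProperPower p.1 ∧ g = p.1 ^ p.2 then
    (h.choose.2 : ℤ) ^ 2 * ((sTwo h.choose.1 / 2 : ℕ) : ℤ) + (h.choose.2 : ℤ) - 1
  else 0
/-- The three-letter alphabet `{x, y, z}`. -/
inductive Letter | x | y | z
deriving DecidableEq

/-- The letter of `w` at cyclic position `i`. -/
def cget (w : List Letter) (i : ℕ) : Letter := w.getD (i % w.length) Letter.x

/-- `w` is cyclically reduced: nonempty, and any two cyclically consecutive letters differ. -/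
def CyclRed (w : List Letter) : Prop :=
  w ≠ [] ∧ ∀ i : ℕ, i < w.length → cget w i ≠ cget w (i + 1)

/-- The matrix assigned to a consecutive pair of letters:
`xy ↦ A`, `yx ↦ A⁻¹`, `yz ↦ B`, `zy ↦ B⁻¹`, `zx ↦ C`, `xz ↦ C⁻¹`. -/
def pairM : Letter → Letter → SL2Z
  | .x, .y => Amat
  | .y, .x => Amat⁻¹
  | .y, .z => Bmat
  | .z, .y => Bmat⁻¹
  | .z, .x => Cmat
  | .x, .z => Cmat⁻¹
  | _, _ => 1

/-- `φ(w)`: group the letters of `w` into consecutive pairs and multiply the matrices. -/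
def phiM : List Letter → SL2Z
  | [] => 1
  | [_] => 1
  | a :: b :: t => pairM a b * phiM t

lemma pairM_mem (a b : Letter) : pairM a b ∈ Gamma := by
  have hA : Amat ∈ Gamma := Subgroup.subset_closure (by simp)
  have hB : Bmat ∈ Gamma := Subgroup.subset_closure (by simp)
  have hC : Cmat ∈ Gamma := inv_mem (mul_mem hA hB)
  cases a <;> cases b <;>
    simp only [pairM] <;>
    first
      | exact hA | exact hB | exact hC
      | exact inv_mem hA | exact inv_mem hB | exact inv_mem hC
      | exact one_mem _

lemma phiM_mem : ∀ w : List Letter, phiM w ∈ Gamma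
  | [] => one_mem _
  | [_] => one_mem _
  | _ :: b :: t => mul_mem (pairM_mem _ b) (phiM_mem t)

/-- The self-intersection number of the word `w`. -/
noncomputable def Iw (w : List Letter) : ℤ := Iγ ⟨phiM w, phiM_mem w⟩

/-- The combinatorial length `L(w)` (half the number of letters). -/
def Lw (w : List Letter) : ℤ := (w.length : ℤ) / 2
/-- `w` is primitive: as a cyclic word it is not a `k`-fold concatenation of a
shorter word for any `k ≥ 2`. -/
def Primitive (w : List Letter) : Prop :=
  ¬ ∃ u : List Letter, ∃ k : ℕ, 2 ≤ k ∧ u.length < w.length ∧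
      ∃ j : ℕ, w.rotate j = (List.replicate k u).flatten

/-- `w` represents a class of `𝒢`: primitive, cyclically reduced, of even length at least 4. -/
def InG (w : List Letter) : Prop :=
  CyclRed w ∧ Primitive w ∧ 2 ∣ w.length ∧ 4 ≤ w.length

/-- Words representing classes of `𝒢`. -/
def GWord := {w : List Letter // InG w}

/-- `v` is obtained from `u`, or from its reversal, by a cyclic rotation through an
even number of places. -/
def WordEquiv (u v : List Letter) : Prop :=
  ∃ k : ℕ, 2 ∣ k ∧ (v = u.rotate k ∨ v = u.reverse.rotate k)

def GEquiv (u v : GWord) : Prop := WordEquiv u.1 v.1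

/-- The set `𝒢` of equivalence classes. -/
def GClass := Quot GEquiv

/-- The defect `δ(w) = I(w) - L(w)`. -/
noncomputable def deltaW (w : List Letter) : ℤ := Iw w - Lw w

/-- `N_δ(L)`: the number of classes `[w] ∈ 𝒢` with `L(w) = L` and `δ(w) = δ`. -/
noncomputable def Ncount (d L : ℤ) : ℕ :=
  Nat.card {c : GClass // ∃ w : GWord, Quot.mk GEquiv w = c ∧ Lw w.1 = L ∧ deltaW w.1 = d}
/-- The positions `i, i+1, …, i+len-1` (cyclically) form a run of `w`: a maximal cyclic
interval whose letters lie in a two-element subset of `{x, y, z}`. -/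
def RunAt (w : List Letter) (i len : ℕ) : Prop :=
  i < w.length ∧ 2 ≤ len ∧ len < w.length ∧
  (∃ T : Finset Letter, T.card = 2 ∧ ∀ j, j < len → cget w (i + j) ∈ T) ∧
  ¬ (∃ T : Finset Letter, T.card = 2 ∧ ∀ j, j < len + 1 → cget w (i + j) ∈ T) ∧
  ¬ (∃ T : Finset Letter, T.card = 2 ∧ ∀ j, j < len + 1 → cget w (i + w.length - 1 + j) ∈ T)

/-- The type of the run starting at position `i`: the two-element subset of letters it uses. -/
def runType (w : List Letter) (i : ℕ) : Finset Letter := {cget w i, cget w (i + 1)}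

/-- The expansion `w⁺[r]` of `w` at the run starting at position `i`: repeat the
first two letters of the run. -/
def expandAt (w : List Letter) (i : ℕ) : List Letter :=
  w.take i ++ [cget w i, cget w (i + 1)] ++ w.drop i

/-- The contraction `w⁻[r]` of `w` at the run starting at position `i`: delete the
first two letters of the run. -/
def contractAt (w : List Letter) (i : ℕ) : List Letter :=
  if i + 1 < w.length then w.take i ++ w.drop (i + 2)
  else (w.drop 1).dropLast

/-- The run at `(i, len)` is distinguished: strictly longer than every other run of the
same type. -/
def DistinguishedRun (w : List Letter) (i len : ℕ) : Prop :=
  RunAt w i len ∧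
    ∀ i' len', RunAt w i' len' → runType w i' = runType w i → i' ≠ i → len' < len

/-- The rank `ρ(w)`: the number of distinguished runs of `w`. -/
noncomputable def rank (w : List Letter) : ℕ :=
  Nat.card {p : ℕ × ℕ // DistinguishedRun w p.1 p.2}

/-- The motif condition: every run `r` with `ℓ(r) ≥ 4` admits another run `s` of the same
type with `ℓ(r) ≤ ℓ(s) + 2`. -/
def MotifCond (w : List Letter) : Prop :=
  ∀ i len, RunAt w i len → 4 ≤ len →
    ∃ i' len', RunAt w i' len' ∧ runType w i' = runType w i ∧ i' ≠ i ∧ len ≤ len' + 2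

/-- The binomial coefficient `C(n, k)` with the convention that it vanishes when `n` or `k`
is negative, except `C(-1, -1) = 1`. -/
def binC (n k : ℤ) : ℤ :=
  if n = -1 ∧ k = -1 then 1
  else if 0 ≤ n ∧ 0 ≤ k then (n.toNat.choose k.toNat : ℤ)
  else 0

/-- The word-level descendants of `w`: the smallest collection containing `w` and closed
under expansion at distinguished runs. -/
inductive Desc (w : List Letter) : List Letter → Prop
  | base : Desc w w
  | step (v : List Letter) (i len : ℕ) :
      Desc w v → DistinguishedRun v i len → Desc w (expandAt v i)

namespace AlmostSimple

open Set

/-! ### Linked pairs of points on the circle -/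

lemma linked_pair_iff_component (P : Set (OnePoint ℝ)) (q₁ q₂ : OnePoint ℝ) :
    Linked P {q₁, q₂} ↔ connectedComponentIn Pᶜ q₁ ≠ connectedComponentIn Pᶜ q₂ := by
  constructor
  · rintro ⟨a, b, -, hq, hne⟩
    rcases Set.pair_eq_pair_iff.1 hq with ⟨rfl, rfl⟩ | ⟨rfl, rfl⟩
    exacts [hne, hne.symm]
  · intro h
    exact ⟨q₁, q₂, fun e => h (e ▸ rfl), rfl, h⟩

lemma not_linked_of_preconnected {P S : Set (OnePoint ℝ)} {q₁ q₂ : OnePoint ℝ}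
    (hS : IsPreconnected S) (hSP : S ⊆ Pᶜ) (h₁ : q₁ ∈ S) (h₂ : q₂ ∈ S) :
    ¬ Linked P {q₁, q₂} := by
  rw [linked_pair_iff_component, not_not]
  exact connectedComponentIn_eq (hS.subset_connectedComponentIn h₁ hSP h₂)

lemma not_linked_self (q₁ q₂ : OnePoint ℝ) : ¬ Linked {q₁, q₂} {q₁, q₂} := by
  rw [linked_pair_iff_component, not_not, connectedComponentIn_eq_empty (by simp),
    connectedComponentIn_eq_empty (by simp)]

lemma linked_of_separation {P U V : Set (OnePoint ℝ)} {q₁ q₂ : OnePoint ℝ}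
    (hU : IsOpen U) (hV : IsOpen V) (hUV : Disjoint U V) (hP : Pᶜ ⊆ U ∪ V)
    (h₁ : q₁ ∈ U) (h₂ : q₂ ∈ V) (h₂P : q₂ ∉ P) (h₁P : q₁ ∉ P) : Linked P {q₁, q₂} := by
  rw [linked_pair_iff_component]
  intro h
  have hm : q₂ ∈ connectedComponentIn Pᶜ q₁ := h ▸ mem_connectedComponentIn h₂P
  have hpre : IsPreconnected (connectedComponentIn Pᶜ q₁) := isPreconnected_connectedComponentIn
  have := hpre.subset_left_of_subset_union hU hV hUV
    ((connectedComponentIn_subset _ _).trans hP) ⟨q₁, mem_connectedComponentIn h₁P, h₁⟩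
  exact hUV.le_bot ⟨this hm, h₂⟩

lemma isPreconnected_coe_image {s : Set ℝ} (hs : IsPreconnected s) :
    IsPreconnected ((↑) '' s : Set (OnePoint ℝ)) :=
  hs.image _ OnePoint.continuous_coe.continuousOn

lemma isPreconnected_compl_Icc {a b : ℝ} :
    IsPreconnected (((↑) '' Icc a b)ᶜ : Set (OnePoint ℝ)) := by
  have hd : ∀ s : Set ℝ, IsPreconnected s → (¬ ∃ K, IsCompact K ∧ s ⊆ K) →
      IsPreconnected (insert OnePoint.infty ((↑) '' s) : Set (OnePoint ℝ)) := by
    intro s hs hK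
    refine (isPreconnected_coe_image hs).subset_closure (subset_insert _ _)
      (insert_subset ?_ subset_closure)
    rw [mem_closure_iff]
    intro o ho hio
    have ho' := ((OnePoint.isOpen_iff_of_mem hio).1 ho).2
    by_contra hne
    refine hK ⟨_, ho', fun t ht hto => hne ⟨↑t, hto, t, ht, rfl⟩⟩
  have h1 := hd (Iio a) isPreconnected_Iio (by
    rintro ⟨K, hK, hs⟩
    exact not_bddBelow_Iio a (hK.bddBelow.mono hs))
  have h2 := hd (Ioi b) isPreconnected_Ioi (by
    rintro ⟨K, hK, hs⟩
    exact not_bddAbove_Ioi b (hK.bddAbove.mono hs))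
  convert IsPreconnected.union OnePoint.infty (mem_insert _ _) (mem_insert _ _) h1 h2 using 1
  rw [OnePoint.compl_image_coe]
  ext p
  induction p using OnePoint.rec with
  | infty => simp
  | coe t =>
    simp only [mem_union, mem_image, OnePoint.coe_eq_coe, exists_eq_right, mem_compl_iff, mem_Icc,
      mem_singleton_iff, OnePoint.coe_ne_infty, mem_insert_iff, mem_Iio, mem_Ioi]
    grind

lemma linked_coe_iff_of_lt {p₁ p₂ q₁ q₂ : ℝ} (hp : p₁ < p₂) (h₁ : q₁ ≠ p₁) (h₂ : q₁ ≠ p₂)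
    (h₃ : q₂ ≠ p₁) (h₄ : q₂ ≠ p₂) :
    Linked {(p₁ : OnePoint ℝ), ↑p₂} {(q₁ : OnePoint ℝ), ↑q₂} ↔
      ¬ (q₁ ∈ Ioo p₁ p₂ ↔ q₂ ∈ Ioo p₁ p₂) := by
  have hin : ((↑) '' Ioo p₁ p₂ : Set (OnePoint ℝ)) ⊆ {(p₁ : OnePoint ℝ), ↑p₂}ᶜ := by
    rintro _ ⟨t, ht, rfl⟩
    simp only [mem_compl_iff, mem_insert_iff, OnePoint.coe_eq_coe, mem_singleton_iff]
    exact fun h => h.elim ht.1.ne' ht.2.ne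
  have hout : (((↑) '' Icc p₁ p₂)ᶜ : Set (OnePoint ℝ)) ⊆ {(p₁ : OnePoint ℝ), ↑p₂}ᶜ := by
    rw [compl_subset_compl]
    rintro _ (rfl | rfl)
    exacts [⟨p₁, left_mem_Icc.2 hp.le, rfl⟩, ⟨p₂, right_mem_Icc.2 hp.le, rfl⟩]
  have hmem : ∀ q, q ≠ p₁ → q ≠ p₂ → q ∉ Ioo p₁ p₂ →
      (q : OnePoint ℝ) ∈ (((↑) '' Icc p₁ p₂)ᶜ : Set (OnePoint ℝ)) := by
    rintro q h h' hq ⟨t, ht, e⟩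
    obtain rfl := OnePoint.coe_injective e
    exact hq ⟨lt_of_le_of_ne ht.1 h.symm, lt_of_le_of_ne ht.2 h'⟩
  have hoI : IsOpen ((↑) '' Ioo p₁ p₂ : Set (OnePoint ℝ)) :=
    OnePoint.isOpen_image_coe.2 isOpen_Ioo
  have hoO : IsOpen (((↑) '' Icc p₁ p₂)ᶜ : Set (OnePoint ℝ)) :=
    OnePoint.isOpen_compl_image_coe.2 ⟨isClosed_Icc, isCompact_Icc⟩
  have hdis : Disjoint ((↑) '' Ioo p₁ p₂ : Set (OnePoint ℝ)) ((↑) '' Icc p₁ p₂)ᶜ :=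
    disjoint_compl_right.mono_left (image_mono Ioo_subset_Icc_self)
  have hcov : ({(p₁ : OnePoint ℝ), ↑p₂}ᶜ : Set (OnePoint ℝ)) ⊆
      (↑) '' Ioo p₁ p₂ ∪ ((↑) '' Icc p₁ p₂)ᶜ := by
    intro p hp'
    induction p using OnePoint.rec with
    | infty => exact Or.inr (by simp)
    | coe t =>
      simp only [mem_compl_iff, mem_insert_iff, OnePoint.coe_eq_coe, mem_singleton_iff,
        not_or] at hp'
      by_cases ht : t ∈ Ioo p₁ p₂
      · exact Or.inl ⟨t, ht, rfl⟩
      · exact Or.inr (hmem t hp'.1 hp'.2 ht)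
  have hn : ∀ q, q ≠ p₁ → q ≠ p₂ → (q : OnePoint ℝ) ∉ ({(p₁ : OnePoint ℝ), ↑p₂} : Set _) := by
    intro q h h'
    simp [h, h']
  by_cases a₁ : q₁ ∈ Ioo p₁ p₂ <;> by_cases a₂ : q₂ ∈ Ioo p₁ p₂
  · simp only [a₁, a₂, not_true_eq_false, iff_false]
    exact not_linked_of_preconnected (isPreconnected_coe_image isPreconnected_Ioo) hin
      ⟨_, a₁, rfl⟩ ⟨_, a₂, rfl⟩
  · simp only [a₁, a₂, iff_false, not_true_eq_false, not_false_eq_true, iff_true]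
    exact linked_of_separation hoI hoO hdis hcov ⟨_, a₁, rfl⟩ (hmem _ h₃ h₄ a₂) (hn _ h₃ h₄)
      (hn _ h₁ h₂)
  · simp only [a₁, a₂, iff_true, not_false_eq_true]
    exact linked_of_separation hoO hoI hdis.symm (hcov.trans (union_comm _ _).subset)
      (hmem _ h₁ h₂ a₁) ⟨_, a₂, rfl⟩ (hn _ h₃ h₄) (hn _ h₁ h₂)
  · simp only [a₁, a₂, not_true_eq_false, iff_false]
    exact not_linked_of_preconnected isPreconnected_compl_Icc hout
      (hmem _ h₁ h₂ a₁) (hmem _ h₃ h₄ a₂)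

lemma linked_image_iff (e : OnePoint ℝ ≃ₜ OnePoint ℝ) (P : Set (OnePoint ℝ))
    (q₁ q₂ : OnePoint ℝ) : Linked (e '' P) {e q₁, e q₂} ↔ Linked P {q₁, q₂} := by
  have key : ∀ q, connectedComponentIn (e '' P)ᶜ (e q) = e '' connectedComponentIn Pᶜ q := by
    intro q
    by_cases hq : q ∈ P
    · rw [connectedComponentIn_eq_empty (by simpa using hq),
        connectedComponentIn_eq_empty (by simpa using hq), image_empty]
    · rw [e.image_connectedComponentIn (mem_compl hq), image_compl_eq e.bijective]
  rw [linked_pair_iff_component, linked_pair_iff_component, key, key,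
    (image_injective.2 e.injective).ne_iff]

/-! ### The three arcs cut out by the vertices of the ideal triangle -/

/-- The open arc of the circle cut off by the side of the ideal triangle labelled by a letter. -/
def arc : Letter → Set ℝ
  | .x => Ioi 1
  | .y => Iio 0
  | .z => Ioo 0 1

/-- The successor of a letter in the cyclic order of the arcs. -/
def nextL : Letter → Letter
  | .y => .z
  | .z => .x
  | .x => .y

lemma arc_isPreconnected (a : Letter) : IsPreconnected (arc a) := by
  cases a
  exacts [isPreconnected_Ioi, isPreconnected_Iio, isPreconnected_Ioo]

lemma arc_disjoint {a b : Letter} {t : ℝ} (ha : t ∈ arc a) (hb : t ∈ arc b) : a = b := by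
  cases a <;> cases b <;> first | rfl | (simp only [arc, mem_Ioi, mem_Iio, mem_Ioo] at ha hb; grind)

lemma linked_arc_iff {a b c : Letter} (hab : a ≠ b) (hac : a ≠ c) (hbc : b ≠ c) {p x q y : ℝ}
    (hp : p ∈ arc a) (hx : x ∈ arc b) (hq : q ∈ arc c) (hy : y ∈ arc b) (hxy : x ≠ y) :
    Linked {(x : OnePoint ℝ), ↑p} {(y : OnePoint ℝ), ↑q} ↔ (y < x ↔ b = nextL a) := by
  have h₁ : y ≠ p := fun e => hab (arc_disjoint hp (e ▸ hy))
  have h₂ : q ≠ x := fun e => hbc (arc_disjoint hx (e ▸ hq))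
  have h₃ : q ≠ p := fun e => hac (arc_disjoint hp (e ▸ hq))
  have h₄ : p ≠ x := fun e => hab (arc_disjoint (e ▸ hp) hx)
  rcases lt_or_gt_of_ne h₄ with h | h
  · rw [pair_comm (x : OnePoint ℝ), linked_coe_iff_of_lt h h₁ hxy.symm h₃ h₂]
    cases a <;> cases b <;> cases c <;> simp_all [arc, nextL] <;> grind
  · rw [linked_coe_iff_of_lt h hxy.symm h₁ h₂ h₃]
    cases a <;> cases b <;> cases c <;> simp_all [arc, nextL] <;> grind

open Filter Topology

/-! ### Reflections in the sides of the ideal triangle -/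

/-- The reflection in the side labelled by a letter, as a matrix. -/
noncomputable def reflGL : Letter → GL (Fin 2) ℝ
  | .x => .mkOfDetNeZero !![-1, 2; 0, 1] (by simp [Matrix.det_fin_two_of])
  | .y => .mkOfDetNeZero !![-1, 0; 0, 1] (by simp [Matrix.det_fin_two_of])
  | .z => .mkOfDetNeZero !![1, 0; 2, -1] (by simp [Matrix.det_fin_two_of])

/-- The reflection in the side labelled by a letter, acting on the circle. -/
noncomputable def refl (a : Letter) : Equiv.Perm (OnePoint ℝ) :=
  MulAction.toPermHom (GL (Fin 2) ℝ) (OnePoint ℝ) (reflGL a)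

/-- The reflection on the finite part of the circle. -/
noncomputable def reflR : Letter → ℝ → ℝ
  | .x, t => 2 - t
  | .y, t => -t
  | .z, t => t / (2 * t - 1)

lemma refl_mul_self (a : Letter) : refl a * refl a = 1 := by
  have h : reflGL a * reflGL a = 1 := by
    ext i j
    cases a <;> fin_cases i <;> fin_cases j <;>
      simp [reflGL, Matrix.GeneralLinearGroup.mkOfDetNeZero, Matrix.mul_apply]
  rw [refl, ← map_mul, h, map_one]

lemma refl_inv (a : Letter) : (refl a)⁻¹ = refl a :=
  inv_eq_of_mul_eq_one_left (refl_mul_self a)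

lemma refl_refl (a : Letter) (p : OnePoint ℝ) : refl a (refl a p) = p := by
  rw [← Equiv.Perm.mul_apply, refl_mul_self, Equiv.Perm.one_apply]

lemma refl_infty (a : Letter) :
    refl a OnePoint.infty = if a = .z then ((1 / 2 : ℝ) : OnePoint ℝ) else OnePoint.infty := by
  cases a <;> simp [refl, OnePoint.smul_infty_eq_ite, reflGL,
    Matrix.GeneralLinearGroup.mkOfDetNeZero]

lemma refl_coe (a : Letter) (t : ℝ) :
    refl a (t : OnePoint ℝ) =
      if a = .z ∧ t = 1 / 2 then OnePoint.infty else (reflR a t : OnePoint ℝ) := by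
  have h : 2 * t - 1 = 0 ↔ t = 2⁻¹ := by constructor <;> intro h <;> linarith
  cases a <;> simp [refl, OnePoint.smul_some_eq_ite, reflGL, reflR,
    Matrix.GeneralLinearGroup.mkOfDetNeZero, ← sub_eq_add_neg, h]
  ring

lemma reflR_mem {a b : Letter} (hab : a ≠ b) {t : ℝ} (ht : t ∈ arc b) : reflR a t ∈ arc a := by
  cases a <;> cases b <;> simp_all [arc, reflR]
  · linarith
  · linarith
  · linarith
  · have : 0 < 2 * t - 1 := by linarith
    exact ⟨by positivity, by rw [div_lt_one this]; linarith⟩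
  · have : 2 * t - 1 < 0 := by linarith
    exact ⟨div_pos_of_neg_of_neg ht this, by rw [div_lt_one_of_neg this]; linarith⟩

lemma refl_coe_of_mem {a b : Letter} (hab : a ≠ b) {t : ℝ} (ht : t ∈ arc b) :
    refl a (t : OnePoint ℝ) = (reflR a t : OnePoint ℝ) := by
  rw [refl_coe, if_neg]
  rintro ⟨rfl, rfl⟩
  cases b <;> simp_all [arc] <;> norm_num at ht

lemma reflR_lt_iff_of_eq {a b : Letter} (hab : a ≠ b) {s t : ℝ} (hs : s ∈ arc b)
    (ht : t ∈ arc b) : reflR a t < reflR a s ↔ s < t := by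
  cases a <;> cases b <;> simp_all [arc, reflR]
  · have h₁ : 0 < 2 * t - 1 := by linarith
    have h₂ : 0 < 2 * s - 1 := by linarith
    rw [div_lt_div_iff₀ h₁ h₂]
    constructor <;> intro h <;> nlinarith
  · have h₁ : 0 < 1 - 2 * t := by linarith
    have h₂ : 0 < 1 - 2 * s := by linarith
    rw [show t / (2 * t - 1) = (-t) / (1 - 2 * t) by rw [← neg_div_neg_eq]; congr 1; ring,
      show s / (2 * s - 1) = (-s) / (1 - 2 * s) by rw [← neg_div_neg_eq]; congr 1; ring,
      div_lt_div_iff₀ h₁ h₂]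
    constructor <;> intro h <;> nlinarith

lemma reflR_lt_iff_of_ne {a b c : Letter} (hab : a ≠ b) (hac : a ≠ c) (hbc : b ≠ c) {s t : ℝ}
    (hs : s ∈ arc b) (ht : t ∈ arc c) : reflR a t < reflR a s ↔ b = nextL a := by
  cases a <;> cases b <;> cases c <;> simp_all [arc, reflR, nextL]
  · linarith
  · linarith
  · linarith
  · linarith
  · have h₁ : 0 < 2 * s - 1 := by linarith
    have h₂ : 0 < 1 - 2 * t := by linarith
    rw [show t / (2 * t - 1) = (-t) / (1 - 2 * t) by rw [← neg_div_neg_eq]; congr 1; ring,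
      div_lt_div_iff₀ h₂ h₁]
    nlinarith
  · have h₁ : 0 < 2 * t - 1 := by linarith
    have h₂ : 0 < 1 - 2 * s := by linarith
    rw [show s / (2 * s - 1) = (-s) / (1 - 2 * s) by rw [← neg_div_neg_eq]; congr 1; ring,
      div_le_div_iff₀ h₂ h₁]
    nlinarith

lemma continuous_refl (a : Letter) : Continuous (refl a) := by
  have haff : ∀ e : ℝ ≃ₜ ℝ, (∀ p, refl a p = OnePoint.map e p) → Continuous (refl a) := by
    intro e h
    rw [show ⇑(refl a) = OnePoint.map e from funext h]
    exact (e.onePointCongr).continuous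
  rcases eq_or_ne a .z with rfl | hz
  · have hform : ∀ t : ℝ, t ≠ 1 / 2 → refl .z (t : OnePoint ℝ) =
        ((1 / 2 + 1 / 4 * (t - 1 / 2)⁻¹ : ℝ) : OnePoint ℝ) := by
      intro t ht
      have h₁ : t - 1 / 2 ≠ 0 := sub_ne_zero.2 ht
      have h₂ : 2 * t - 1 ≠ 0 := fun h => ht (by linarith)
      rw [refl_coe, if_neg (fun h => ht h.2), reflR]
      congr 1
      rw [show t - 1 / 2 = (2 * t - 1) / 2 by ring]
      obtain ⟨u, rfl⟩ : ∃ u, t = (u + 1) / 2 := ⟨2 * t - 1, by ring⟩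
      rw [show 2 * ((u + 1) / 2) - 1 = u by ring] at h₂ ⊢
      field_simp
      ring
    rw [OnePoint.continuous_iff, continuous_iff_continuousAt, refl_infty, if_pos rfl]
    constructor
    · have h : Tendsto (fun t : ℝ => 1 / 2 + 1 / 4 * (t - 1 / 2)⁻¹) (cocompact ℝ) (𝓝 (1 / 2)) := by
        rw [← Metric.cobounded_eq_cocompact]
        have := (tendsto_inv₀_cobounded (α := ℝ)).comp (tendsto_sub_const_cobounded (1 / 2 : ℝ))
        convert! (this.const_mul (1 / 4)).const_add (1 / 2) using 2
        norm_num
      rw [coclosedCompact_eq_cocompact]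
      refine ((OnePoint.continuous_coe.tendsto _).comp h).congr' ?_
      filter_upwards [(isCompact_singleton (x := (1 / 2 : ℝ))).compl_mem_cocompact] with t ht
      exact (hform t ht).symm
    · intro t
      rcases eq_or_ne t (1 / 2) with rfl | ht
      · rw [ContinuousAt, refl_coe, if_pos ⟨rfl, rfl⟩, ← nhdsNE_sup_pure, tendsto_sup]
        refine ⟨?_, ?_⟩
        · have h : Tendsto (fun t : ℝ => 1 / 2 + 1 / 4 * (t - 1 / 2)⁻¹) (𝓝[≠] (1 / 2))
              (cocompact ℝ) := by
            rw [← Metric.cobounded_eq_cocompact]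
            have h₀ : Tendsto (fun t : ℝ => t - 1 / 2) (𝓝[≠] (1 / 2)) (𝓝[≠] 0) := by
              refine tendsto_nhdsWithin_iff.2 ⟨?_, ?_⟩
              · have : Continuous fun t : ℝ => t - 1 / 2 := by fun_prop
                simpa using (this.tendsto (1 / 2)).mono_left nhdsWithin_le_nhds
              · filter_upwards [self_mem_nhdsWithin] with t ht
                exact sub_ne_zero.2 ht
            exact (tendsto_const_add_cobounded _).comp
              ((tendsto_mul_left_cobounded (by norm_num)).comp (tendsto_inv₀_nhdsNE_zero.comp h₀))
          rw [← coclosedCompact_eq_cocompact] at h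
          refine (OnePoint.tendsto_coe_infty.comp h).congr' ?_
          filter_upwards [self_mem_nhdsWithin] with t ht
          exact (hform t ht).symm
        · rw [tendsto_pure_left]
          intro s hs
          rw [refl_coe, if_pos ⟨rfl, rfl⟩]
          exact mem_of_mem_nhds hs
      · have : ContinuousAt
            (fun t : ℝ => ((1 / 2 + 1 / 4 * (t - 1 / 2)⁻¹ : ℝ) : OnePoint ℝ)) t := by
          refine OnePoint.continuous_coe.continuousAt.comp
            (f := fun t : ℝ => 1 / 2 + 1 / 4 * (t - 1 / 2)⁻¹) ?_
          exact continuousAt_const.add (continuousAt_const.mul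
            ((continuousAt_id.sub continuousAt_const).inv₀ (sub_ne_zero.2 ht)))
        refine this.congr ?_
        filter_upwards [isOpen_ne.mem_nhds ht] with s hs
        exact (hform s hs).symm
  · have hc : Continuous (reflR a) := by
      cases a
      exacts [continuous_const.sub continuous_id, continuous_neg, absurd rfl hz]
    refine haff ⟨⟨reflR a, reflR a, ?_, ?_⟩, ?_, ?_⟩ ?_
    · intro t; cases a <;> simp_all [reflR]
    · intro t; cases a <;> simp_all [reflR]
    · exact hc
    · exact hc
    · intro p
      induction p using OnePoint.rec with
      | infty => simp [refl_infty, hz]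
      | coe t => simp [refl_coe, hz]

/-- The reflection as a homeomorphism of the circle. -/
noncomputable def reflHomeo (a : Letter) : OnePoint ℝ ≃ₜ OnePoint ℝ where
  toEquiv := refl a
  continuous_toFun := continuous_refl a
  continuous_invFun := by
    show Continuous ((refl a)⁻¹ : Equiv.Perm _)
    rw [refl_inv]
    exact continuous_refl a

/-! ### The action of `SL₂(ℤ)` -/

/-- The action of `SL₂(ℤ)` on the circle as a group homomorphism. -/
noncomputable def act : SL2Z →* Equiv.Perm (OnePoint ℝ) :=
  (MulAction.toPermHom (GL (Fin 2) ℝ) (OnePoint ℝ)).comp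
    (Matrix.SpecialLinearGroup.toGL.comp
      (Matrix.SpecialLinearGroup.map (Int.castRingHom ℝ)))

lemma mobius_eq_act (g : SL2Z) (p : OnePoint ℝ) : mobius g p = act g p := by
  induction p using OnePoint.rec with
  | infty =>
    simp only [act, MonoidHom.comp_apply, MulAction.toPermHom_apply, MulAction.toPerm_apply,
      OnePoint.smul_infty_eq_ite]
    simp [mobius, entry, OnePoint.infty]
  | coe t =>
    simp only [act, MonoidHom.comp_apply, MulAction.toPermHom_apply, MulAction.toPerm_apply,
      OnePoint.smul_some_eq_ite]
    simp [mobius, entry, OnePoint.some]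
    rfl

lemma act_eq_of_coe_eq_neg {g h : GL (Fin 2) ℝ}
    (H : ∀ i j, g i j = - h i j) (p : OnePoint ℝ) : g • p = h • p := by
  induction p using OnePoint.rec with
  | infty => simp [OnePoint.smul_infty_eq_ite, H, neg_div_neg_eq]
  | coe t =>
    rw [OnePoint.smul_some_eq_ite, OnePoint.smul_some_eq_ite]
    simp only [H, neg_mul, ← neg_add, neg_eq_zero, neg_div_neg_eq]

lemma toGL_map_apply (g : SL2Z) (i j : Fin 2) :
    ((Matrix.SpecialLinearGroup.map (Int.castRingHom ℝ) g : Matrix.SpecialLinearGroup (Fin 2) ℝ) :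
      Matrix (Fin 2) (Fin 2) ℝ) i j = (g i j : ℝ) := rfl

lemma act_Amat : act Amat = refl .x * refl .y := by
  simp only [act, refl, MonoidHom.comp_apply, ← map_mul]
  congr 1
  ext i j
  fin_cases i <;> fin_cases j <;>
    refine (toGL_map_apply _ _ _).trans ?_ <;>
    simp [reflGL, Matrix.GeneralLinearGroup.mkOfDetNeZero, Matrix.mul_apply, Amat]

lemma act_Bmat : act Bmat = refl .y * refl .z := by
  simp only [act, refl, MonoidHom.comp_apply, ← map_mul]
  ext p : 1
  refine act_eq_of_coe_eq_neg (fun i j => ?_) p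
  fin_cases i <;> fin_cases j <;>
    refine (toGL_map_apply _ _ _).trans ?_ <;>
    simp [reflGL, Matrix.GeneralLinearGroup.mkOfDetNeZero, Matrix.mul_apply, Bmat]

lemma act_Cmat : act Cmat = refl .z * refl .x := by
  rw [Cmat, map_inv, map_mul, act_Amat, act_Bmat, mul_assoc, ← mul_assoc (refl .y),
    refl_mul_self, one_mul, mul_inv_rev, refl_inv, refl_inv]

lemma act_pairM {a b : Letter} : act (pairM a b) = refl a * refl b := by
  cases a <;> cases b <;>
    simp only [pairM, map_inv, map_one, act_Amat, act_Bmat, act_Cmat, refl_mul_self, mul_inv_rev,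
      refl_inv]

/-- The element of the reflection group given by a word. -/
noncomputable def wordPerm (w : List Letter) : Equiv.Perm (OnePoint ℝ) := (w.map refl).prod

@[simp] lemma wordPerm_nil : wordPerm [] = 1 := rfl

@[simp] lemma wordPerm_cons (a : Letter) (w : List Letter) :
    wordPerm (a :: w) = refl a * wordPerm w := by simp [wordPerm]

@[simp] lemma wordPerm_append (u w : List Letter) :
    wordPerm (u ++ w) = wordPerm u * wordPerm w := by simp [wordPerm]

lemma wordPerm_reverse (w : List Letter) : wordPerm w.reverse = (wordPerm w)⁻¹ := by
  induction w with
  | nil => simp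
  | cons a t ih => simp [ih, refl_inv]

lemma act_phiM : ∀ w : List Letter, Even w.length → act (phiM w) = wordPerm w
  | [], _ => by simp [phiM]
  | [_], h => by simp at h
  | a :: b :: t, h => by
    rw [phiM, map_mul, act_pairM, act_phiM t (by simpa [Nat.even_add_one] using h)]
    simp [mul_assoc]

lemma exists_word_of_mem_Gamma {g : SL2Z} (hg : g ∈ Gamma) :
    ∃ w : List Letter, Even w.length ∧ act g = wordPerm w := by
  induction hg using Subgroup.closure_induction with
  | mem g hg =>
    rcases hg with rfl | rfl
    · exact ⟨[.x, .y], by simp, by simp [act_Amat]⟩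
    · exact ⟨[.y, .z], by simp, by simp [act_Bmat]⟩
  | one => exact ⟨[], by simp, by simp⟩
  | mul g h _ _ ihg ihh =>
    obtain ⟨u, hu, e⟩ := ihg
    obtain ⟨w, hw, e'⟩ := ihh
    exact ⟨u ++ w, by simp [hu.add hw], by simp [e, e']⟩
  | inv g _ ih =>
    obtain ⟨u, hu, e⟩ := ih
    exact ⟨u.reverse, by simpa using hu, by rw [map_inv, e, wordPerm_reverse]⟩

lemma dvd_of_mem_Gamma {g : SL2Z} (hg : g ∈ Gamma) :
    4 ∣ g 0 0 - 1 ∧ 2 ∣ g 0 1 ∧ 2 ∣ g 1 0 ∧ 4 ∣ g 1 1 - 1 := by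
  induction hg using Subgroup.closure_induction with
  | mem g hg => rcases hg with rfl | rfl <;> simp [Amat, Bmat]
  | one => simp
  | mul g h _ _ ihg ihh =>
    obtain ⟨⟨a, ha⟩, ⟨b, hb⟩, ⟨c, hc⟩, ⟨d, hd⟩⟩ := ihg
    obtain ⟨⟨a', ha'⟩, ⟨b', hb'⟩, ⟨c', hc'⟩, ⟨d', hd'⟩⟩ := ihh
    rw [sub_eq_iff_eq_add] at ha hd ha' hd'
    simp only [Matrix.SpecialLinearGroup.coe_mul, Matrix.mul_apply, Fin.sum_univ_two, ha, hb, hc,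
      hd, ha', hb', hc', hd']
    exact ⟨⟨4 * a * a' + a + a' + b * c', by ring⟩, ⟨(4 * a + 1) * b' + b * (4 * d' + 1), by ring⟩,
      ⟨c * (4 * a' + 1) + (4 * d + 1) * c', by ring⟩, ⟨4 * d * d' + d + d' + c * b', by ring⟩⟩
  | inv g _ ih => simpa [Matrix.SpecialLinearGroup.coe_inv, Matrix.adjugate_fin_two, and_comm,
      and_assoc, and_left_comm] using ih

lemma mobius_infty_eq_iff (g : SL2Z) : mobius g OnePoint.infty = OnePoint.infty ↔ g 1 0 = 0 := by
  rw [mobius_eq_act]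
  simp only [act, MonoidHom.comp_apply, MulAction.toPermHom_apply, MulAction.toPerm_apply,
    OnePoint.smul_infty_eq_ite]
  simp [toGL_map_apply]

lemma eq_one_of_act_eq_one {g : SL2Z} (hg : g ∈ Gamma) (e : act g = 1) : g = 1 := by
  have hc : g 1 0 = 0 := by
    rw [← mobius_infty_eq_iff, mobius_eq_act, e]; rfl
  have hdet := Matrix.det_fin_two g.1
  rw [g.2] at hdet
  have hb : g 0 1 = 0 := by
    have h₂ : mobius g ((0 : ℝ) : OnePoint ℝ) = ((0 : ℝ) : OnePoint ℝ) := by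
      rw [mobius_eq_act, e]; rfl
    have hd : g 1 1 ≠ 0 := by rintro h; simp [hc, h] at hdet
    rw [mobius_eq_act] at h₂
    simp only [act, MonoidHom.comp_apply, MulAction.toPermHom_apply, MulAction.toPerm_apply,
      OnePoint.smul_some_eq_ite] at h₂
    simpa [toGL_map_apply, hd, hc] using h₂
  obtain ⟨⟨a, ha⟩, -, -, ⟨d, hd⟩⟩ := dvd_of_mem_Gamma hg
  rw [sub_eq_iff_eq_add] at ha hd
  rw [hb, zero_mul, sub_zero, eq_comm] at hdet
  have h1 := Int.eq_one_or_neg_one_of_mul_eq_one hdet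
  have h2 := Int.eq_one_or_neg_one_of_mul_eq_one' hdet
  ext i j
  fin_cases i <;> fin_cases j
  · show g 0 0 = 1; omega
  · exact hb
  · exact hc
  · show g 1 1 = 1; omega

lemma act_injOn_Gamma {g h : SL2Z} (hg : g ∈ Gamma) (hh : h ∈ Gamma) (e : act g = act h) :
    g = h := by
  rw [← mul_inv_eq_one]
  exact eq_one_of_act_eq_one (mul_mem hg (inv_mem hh)) (by rw [map_mul, map_inv, e, mul_inv_cancel])

/-! ### Bi-infinite words and their partial products -/

/-- A bi-infinite word which is periodic of even period `n`, reduced, of minimal period `n`, and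
which uses all three letters. -/
structure Cyc (f : ℤ → Letter) (n : ℕ) : Prop where
  pos : 0 < n
  even : Even n
  per : ∀ k, f (k + n) = f k
  red : ∀ k, f k ≠ f (k + 1)
  aper : ∀ d : ℤ, (∀ j, f (j + d) = f j) → (n : ℤ) ∣ d
  occ : ∀ a, ∃ k, f k = a

/-- The partial products of the reflections along a bi-infinite word. -/
noncomputable def partialProd (f : ℤ → Letter) : ℤ → Equiv.Perm (OnePoint ℝ)
  | Int.ofNat m => wordPerm ((List.range m).map fun j : ℕ => f j)
  | Int.negSucc m => wordPerm ((List.range (m + 1)).map fun j : ℕ => f (-1 - j))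

/-- The segment of length `m` starting at `k`. -/
def seg (f : ℤ → Letter) (k : ℤ) (m : ℕ) : List Letter := (List.range m).map fun j : ℕ => f (k + j)

section
variable {f : ℤ → Letter}

@[simp] lemma partialProd_zero : partialProd f 0 = 1 := rfl

lemma partialProd_succ (k : ℤ) : partialProd f (k + 1) = partialProd f k * refl (f k) := by
  rcases k with m | m
  · change wordPerm ((List.range (m + 1)).map fun j : ℕ => f j) =
      wordPerm ((List.range m).map fun j : ℕ => f j) * refl (f m)
    simp [List.range_succ]
  · rcases m with _ | m
    · change 1 = wordPerm ((List.range 1).map fun j : ℕ => f (-1 - j)) * refl (f (-1))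
      simp [refl_mul_self]
    · change wordPerm ((List.range (m + 1)).map fun j : ℕ => f (-1 - j)) =
        wordPerm ((List.range (m + 1 + 1)).map fun j : ℕ => f (-1 - j)) *
          refl (f (.negSucc (m + 1)))
      rw [List.range_succ (n := m + 1), List.map_append, wordPerm_append, mul_assoc]
      have : (-1 - ((m + 1 : ℕ) : ℤ)) = Int.negSucc (m + 1) := by
        rw [Int.negSucc_eq]; push_cast; ring
      simp only [List.map_cons, List.map_nil, wordPerm_cons, wordPerm_nil, mul_one, this,
        refl_mul_self]

lemma seg_length (k : ℤ) (m : ℕ) : (seg f k m).length = m := by simp [seg]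

lemma seg_succ (k : ℤ) (m : ℕ) : seg f k (m + 1) = seg f k m ++ [f (k + m)] := by
  simp [seg, List.range_succ]

lemma seg_succ' (k : ℤ) (m : ℕ) : seg f k (m + 1) = f k :: seg f (k + 1) m := by
  simp only [seg, List.range_succ_eq_map, List.map_cons, Nat.cast_zero, add_zero, List.map_map]
  congr 1
  refine List.map_congr_left fun j _ => ?_
  simp only [Function.comp_apply, Nat.succ_eq_add_one, Nat.cast_add, Nat.cast_one]
  congr 1
  ring

lemma partialProd_add (k : ℤ) (m : ℕ) :
    partialProd f (k + m) = partialProd f k * wordPerm (seg f k m) := by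
  induction m with
  | zero => simp [seg]
  | succ m ih =>
    rw [Nat.cast_succ, ← add_assoc, partialProd_succ, ih, seg_succ]
    simp [mul_assoc]

lemma seg_isChain (hf : ∀ k, f k ≠ f (k + 1)) (k : ℤ) (m : ℕ) :
    (seg f k m).IsChain (· ≠ ·) := by
  induction m generalizing k with
  | zero => simp [seg]
  | succ m ih =>
    rw [seg_succ']
    rcases m with _ | m
    · simp [seg]
    · rw [seg_succ', List.isChain_cons_cons, ← seg_succ']
      exact ⟨hf k, ih _⟩

end

/-! ### Ping-pong -/

lemma wordPerm_mem_arc {a c : Letter} {t : List Letter}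
    (h : (a :: (t ++ [c])).IsChain (· ≠ ·)) {s : ℝ} (hs : s ∈ arc c) :
    ∃ s' ∈ arc a, wordPerm (a :: t) (s : OnePoint ℝ) = (s' : OnePoint ℝ) := by
  induction t generalizing a with
  | nil =>
    have hac : a ≠ c := by simpa using h
    exact ⟨_, reflR_mem hac hs, by simpa using refl_coe_of_mem hac hs⟩
  | cons b t ih =>
    rw [List.cons_append, List.isChain_cons_cons] at h
    obtain ⟨s', hs', e⟩ := ih h.2
    exact ⟨_, reflR_mem h.1 hs', by
      rw [wordPerm_cons, Equiv.Perm.mul_apply, e, refl_coe_of_mem h.1 hs']⟩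

lemma exists_ne_ne (a b : Letter) : ∃ c, c ≠ a ∧ c ≠ b := by
  cases a <;> cases b <;>
    first | exact ⟨.x, by decide, by decide⟩ | exact ⟨.y, by decide, by decide⟩ |
      exact ⟨.z, by decide, by decide⟩

lemma arc_nonempty (a : Letter) : (arc a).Nonempty := by
  cases a
  exacts [⟨2, by norm_num [arc]⟩, ⟨-1, by norm_num [arc]⟩, ⟨1 / 2, by norm_num [arc]⟩]

lemma eq_nil_of_wordPerm_eq_one {t : List Letter} (h : t.IsChain (· ≠ ·))
    (e : wordPerm t = 1) : t = [] := by
  by_contra hne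
  obtain ⟨a, t, rfl⟩ := List.exists_cons_of_ne_nil hne
  obtain ⟨c, hca, hc⟩ := exists_ne_ne a ((a :: t).getLast hne)
  obtain ⟨s, hs⟩ := arc_nonempty c
  have h' : (a :: (t ++ [c])).IsChain (· ≠ ·) := by
    rw [← List.cons_append, List.isChain_append]
    refine ⟨h, by simp, ?_⟩
    intro d hx d' hy
    rw [List.getLast?_eq_getLast_of_ne_nil hne] at hx
    simp only [Option.mem_def, Option.some.injEq, List.head?_cons] at hx hy
    rw [← hx, ← hy]
    exact hc.symm
  obtain ⟨s', hs', e'⟩ := wordPerm_mem_arc h' hs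
  rw [e, Equiv.Perm.one_apply] at e'
  exact hca (arc_disjoint hs (OnePoint.coe_injective e' ▸ hs'))

lemma eq_nil_of_wordPerm_eq {u u' : List Letter} (h : u.IsChain (· ≠ ·))
    (h' : u'.IsChain (· ≠ ·)) (hl : ∀ a ∈ u.getLast?, ∀ b ∈ u'.getLast?, a ≠ b)
    (e : wordPerm u = wordPerm u') : u = [] ∧ u' = [] := by
  have : u ++ u'.reverse = [] := by
    refine eq_nil_of_wordPerm_eq_one ?_ (by rw [wordPerm_append, wordPerm_reverse, e,
      mul_inv_cancel])
    rw [List.isChain_append]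
    refine ⟨h, ?_, ?_⟩
    · rw [List.isChain_reverse]
      exact h'.imp fun _ _ => Ne.symm
    · simpa using hl
  simpa using this

lemma wordPerm_vertex {q : OnePoint ℝ}
    (hq : ∀ b, refl b q = q ∨ ∃ s ∈ arc b, refl b q = (s : OnePoint ℝ)) {a : Letter}
    {t : List Letter} (h : (a :: t).IsChain (· ≠ ·)) :
    (∀ b ∈ a :: t, refl b q = q) ∧ wordPerm (a :: t) q = q ∨
      ∃ s ∈ arc a, wordPerm (a :: t) q = (s : OnePoint ℝ) := by
  induction t generalizing a with
  | nil =>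
    rcases hq a with h | h
    · left; simp [h]
    · right; simpa using h
  | cons b t ih =>
    rw [List.isChain_cons_cons] at h
    rw [wordPerm_cons, Equiv.Perm.mul_apply]
    rcases ih h.2 with ⟨h₁, h₂⟩ | ⟨s, hs, e⟩
    · rw [h₂]
      rcases hq a with h' | h'
      · left
        refine ⟨?_, h'⟩
        intro b' hb'
        rcases List.mem_cons.1 hb' with rfl | hb'
        exacts [h', h₁ _ hb']
      · exact Or.inr h'
    · right
      exact ⟨_, reflR_mem h.1 hs, by rw [e, refl_coe_of_mem h.1 hs]⟩

/-- A word ending in `y`, not starting with `y`, and using all three letters maps the closed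
half line `[0, ∞]` into its interior. -/
lemma wordPerm_halfLine {a : Letter} {t : List Letter} (h : (a :: (t ++ [.y])).IsChain (· ≠ ·))
    (ha : a ≠ .y) (hocc : ∀ b, b ∈ a :: (t ++ [.y])) {q : OnePoint ℝ}
    (hq : q = OnePoint.infty ∨ ∃ s : ℝ, 0 ≤ s ∧ q = s) :
    ∃ s : ℝ, 0 < s ∧ wordPerm (a :: (t ++ [.y])) q = s := by
  have hpos : ∀ s ∈ arc a, 0 < s := by
    intro s hs
    cases a
    · exact zero_lt_one.trans hs
    · exact absurd rfl ha
    · exact hs.1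
  suffices ∃ s ∈ arc a, wordPerm (a :: (t ++ [.y])) q = (s : OnePoint ℝ) by
    obtain ⟨s, hs, e⟩ := this
    exact ⟨s, hpos s hs, e⟩
  have hvert : ∀ q : OnePoint ℝ, (∀ b, refl b q = q ∨ ∃ s ∈ arc b, refl b q = (s : OnePoint ℝ)) →
      (∃ b, refl b q ≠ q) → ∃ s ∈ arc a, wordPerm (a :: (t ++ [.y])) q = (s : OnePoint ℝ) := by
    rintro q hq ⟨b, hb⟩
    rcases wordPerm_vertex hq h with h' | h'
    · exact absurd (h'.1 b (hocc b)) hb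
    · exact h'
  have hint : ∀ c, c ≠ .y → ∀ s ∈ arc c,
      ∃ s' ∈ arc a, wordPerm (a :: (t ++ [.y])) (s : OnePoint ℝ) = (s' : OnePoint ℝ) := by
    intro c hc s hs
    refine wordPerm_mem_arc (c := c) ?_ hs
    rw [← List.cons_append, List.isChain_append]
    refine ⟨h, by simp, ?_⟩
    rw [← List.cons_append, List.getLast?_concat]
    simpa using hc.symm
  rcases hq with rfl | ⟨s, hs, rfl⟩
  · refine hvert _ ?_ ⟨.z, by simp [refl_infty]⟩
    intro b
    cases b <;> simp [refl_infty, arc] <;> norm_num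
  · rcases hs.eq_or_lt with rfl | hs
    · refine hvert _ ?_ ⟨.x, by simp [refl_coe, reflR]⟩
      intro b; cases b <;> simp [refl_coe, reflR, arc]
    rcases lt_trichotomy s 1 with h1 | rfl | h1
    · exact hint .z (by decide) s ⟨hs, h1⟩
    · refine hvert _ ?_ ⟨.y, by simp [refl_coe, reflR]; norm_num⟩
      intro b; cases b <;> simp [refl_coe, reflR, arc] <;> norm_num
    · exact hint .x (by decide) s h1

/-! ### Fixed points -/

lemma act_infty (g : SL2Z) : act g OnePoint.infty =
    if (g 1 0 : ℝ) = 0 then OnePoint.infty else ((g 0 0 / g 1 0 : ℝ) : OnePoint ℝ) := by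
  simp only [act, MonoidHom.comp_apply, MulAction.toPermHom_apply, MulAction.toPerm_apply,
    OnePoint.smul_infty_eq_ite]
  rfl

lemma act_coe (g : SL2Z) (t : ℝ) : act g (t : OnePoint ℝ) =
    if (g 1 0 : ℝ) * t + g 1 1 = 0 then OnePoint.infty
    else (((g 0 0 : ℝ) * t + g 0 1) / (g 1 0 * t + g 1 1) : ℝ) := by
  simp only [act, MonoidHom.comp_apply, MulAction.toPermHom_apply, MulAction.toPerm_apply,
    OnePoint.smul_some_eq_ite]
  rfl

lemma mem_fixedSet {g : SL2Z} {p : OnePoint ℝ} : p ∈ fixedSet g ↔ act g p = p := by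
  rw [← mobius_eq_act]; rfl

lemma det_real (g : SL2Z) : (g 0 0 : ℝ) * g 1 1 - g 0 1 * g 1 0 = 1 := by
  have h := Matrix.det_fin_two g.1
  rw [g.2] at h
  exact_mod_cast h.symm

/-- A matrix mapping the closed half line into its interior has exactly two fixed points, one of
each sign. -/
lemma exists_fixed_of_halfLine (g : SL2Z)
    (h : ∀ q : OnePoint ℝ, (q = OnePoint.infty ∨ ∃ s : ℝ, 0 ≤ s ∧ q = s) →
      ∃ s : ℝ, 0 < s ∧ act g q = s) :
    ∃ x y : ℝ, 0 < x ∧ y < 0 ∧ ∀ p, act g p = p ↔ p = ↑x ∨ p = ↑y := by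
  have hdet := det_real g
  obtain ⟨s, hs, e⟩ := h _ (Or.inl rfl)
  obtain ⟨s', hs', e'⟩ := h _ (Or.inr ⟨0, le_rfl, rfl⟩)
  have hpole : ∀ t : ℝ, 0 ≤ t → (g 1 0 : ℝ) * t + g 1 1 ≠ 0 := by
    intro t ht hz
    obtain ⟨s, -, e⟩ := h _ (Or.inr ⟨t, ht, rfl⟩)
    rw [act_coe, if_pos hz] at e
    exact OnePoint.infty_ne_coe _ e
  rw [act_infty] at e
  rw [act_coe] at e'
  split_ifs at e with hc
  · exact absurd e (OnePoint.infty_ne_coe _)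
  split_ifs at e' with hd
  · exact absurd e' (OnePoint.infty_ne_coe _)
  have e := OnePoint.coe_injective e
  have e' := OnePoint.coe_injective e'
  have hfix : ∀ t : ℝ, act g (t : OnePoint ℝ) = t ↔
      (g 1 0 : ℝ) * t ^ 2 + (g 1 1 - g 0 0) * t - g 0 1 = 0 := by
    intro t
    rw [act_coe]
    split_ifs with hz
    · simp only [OnePoint.infty_ne_coe, false_iff]
      intro h0
      have h1 : (g 0 0 : ℝ) * t + g 0 1 = 0 := by linear_combination t * hz - h0
      have : (1 : ℝ) = 0 := by
        linear_combination (-1 : ℝ) * hdet + (g 0 0 : ℝ) * hz - (g 1 0 : ℝ) * h1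
      exact one_ne_zero this
    · rw [OnePoint.coe_eq_coe, div_eq_iff hz]
      constructor <;> intro h <;> linear_combination -h
  have hinf : act g OnePoint.infty ≠ OnePoint.infty := by
    rw [act_infty, if_neg hc]; exact OnePoint.coe_ne_infty _
  generalize (g 0 0 : ℝ) = a at *
  generalize (g 0 1 : ℝ) = b at *
  generalize (g 1 0 : ℝ) = c at *
  generalize (g 1 1 : ℝ) = d at *
  simp only [mul_zero, zero_add] at hd e'
  have hbc : 0 < b / c := by
    have hdc : 0 < d / c := by
      by_contra hneg
      refine hpole (-(d / c)) (by linarith) ?_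
      field_simp
      ring
    have : b / c = (b / d) * (d / c) := by field_simp
    rw [this, e']
    positivity
  set m := (a - d) / (2 * c) with hm
  have hD : 0 < m ^ 2 + b / c := by positivity
  have hr : √(m ^ 2 + b / c) ^ 2 = m ^ 2 + b / c := Real.sq_sqrt hD.le
  have hrm : |m| < √(m ^ 2 + b / c) := by
    rw [← Real.sqrt_sq_eq_abs]
    exact Real.sqrt_lt_sqrt (sq_nonneg _) (by linarith)
  generalize √(m ^ 2 + b / c) = r at *
  obtain ⟨h1, h2⟩ := abs_lt.1 hrm
  refine ⟨m + r, m - r, by linarith, by linarith, fun p => ?_⟩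
  induction p using OnePoint.rec with
  | infty => simp [hinf]
  | coe t =>
    rw [hfix, OnePoint.coe_eq_coe, OnePoint.coe_eq_coe]
    have : c * t ^ 2 + (d - a) * t - b = c * ((t - (m + r)) * (t - (m - r))) := by
      have : (t - (m + r)) * (t - (m - r)) = t ^ 2 - 2 * m * t - b / c := by
        linear_combination -hr
      rw [this, hm]
      field_simp
      ring
    rw [this, mul_eq_zero, mul_eq_zero, sub_eq_zero, sub_eq_zero]
    simp [hc]

lemma hyperbolic_of_fixedSet {g : SL2Z} {x y : ℝ} (hxy : x ≠ y)
    (h : ∀ p, act g p = p ↔ p = ↑x ∨ p = ↑y) : Hyperbolic g := by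
  have hdet := det_real g
  have hx := (h x).2 (Or.inl rfl)
  have hy := (h y).2 (Or.inr rfl)
  have hinf : act g OnePoint.infty ≠ OnePoint.infty := by
    rw [Ne, h]; simp
  rw [act_infty] at hinf
  split_ifs at hinf with hc
  · exact absurd rfl hinf
  rw [act_coe] at hx hy
  split_ifs at hx with hx0
  · exact absurd hx (OnePoint.infty_ne_coe _)
  split_ifs at hy with hy0
  · exact absurd hy (OnePoint.infty_ne_coe _)
  have hx := OnePoint.coe_injective hx
  have hy := OnePoint.coe_injective hy
  have htr : (2 : ℝ) ^ 2 < (g 0 0 + g 1 1 : ℝ) ^ 2 := by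
    generalize (g 0 0 : ℝ) = a at *
    generalize (g 0 1 : ℝ) = b at *
    generalize (g 1 0 : ℝ) = c at *
    generalize (g 1 1 : ℝ) = d at *
    rw [div_eq_iff hx0] at hx
    rw [div_eq_iff hy0] at hy
    have h1 : c * (x + y) = a - d := by
      apply mul_right_cancel₀ (sub_ne_zero.2 hxy)
      linear_combination hy - hx
    have h2 : c * (x * y) = -b := by linear_combination x * h1 + hx
    have : (a + d) ^ 2 - 2 ^ 2 = (c * (x - y)) ^ 2 := by
      linear_combination (-(a - d) - c * (x + y)) * h1 + 4 * c * h2 + 4 * hdet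
    have : 0 < (c * (x - y)) ^ 2 := by
      have := mul_ne_zero hc (sub_ne_zero.2 hxy)
      positivity
    linarith
  rw [Hyperbolic, Matrix.trace_fin_two]
  have : (2 : ℤ) ^ 2 < (g 0 0 + g 1 1) ^ 2 := by exact_mod_cast htr
  have := sq_lt_sq.1 this
  simpa using this

/-! ### The axis of a cyclic word -/

lemma perm_apply_inv {α : Type*} (σ : Equiv.Perm α) (p : α) : σ (σ⁻¹ p) = p :=
  σ.apply_symm_apply p

lemma inv_perm_apply {α : Type*} (σ : Equiv.Perm α) (p : α) : σ⁻¹ (σ p) = p :=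
  σ.symm_apply_apply p

namespace Cyc

variable {f : ℤ → Letter} {n : ℕ}

lemma per_mul (hf : Cyc f n) (k a : ℤ) : f (k + a * n) = f k := by
  induction a with
  | zero => simp
  | succ a ih => rw [← ih, ← hf.per (k + a * n)]; congr 1; ring
  | pred a ih => rw [← ih, ← hf.per (k + (-a - 1) * n)]; congr 1; ring

lemma per_of_dvd (hf : Cyc f n) {k l : ℤ} (h : (n : ℤ) ∣ l - k) : f l = f k := by
  obtain ⟨a, ha⟩ := h
  rw [← hf.per_mul k a]
  congr 1
  linarith

lemma mem_seg (hf : Cyc f n) (k : ℤ) (a : Letter) : a ∈ seg f k n := by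
  obtain ⟨l, rfl⟩ := hf.occ a
  have hn : (0 : ℤ) < n := by exact_mod_cast hf.pos
  have h0 := Int.emod_nonneg (l - k) hn.ne'
  have h1 := Int.emod_lt_of_pos (l - k) hn
  refine List.mem_map.2 ⟨((l - k) % n).toNat, by rw [List.mem_range]; omega, ?_⟩
  refine hf.per_of_dvd ?_
  rw [Int.toNat_of_nonneg h0]
  refine ⟨-((l - k) / n), ?_⟩
  linarith [Int.emod_add_mul_ediv (l - k) n]

lemma partialProd_add_period (hf : Cyc f n) (k : ℤ) :
    partialProd f (k + n) = partialProd f n * partialProd f k := by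
  induction k with
  | zero => simp
  | succ k ih =>
    rw [add_right_comm, partialProd_succ, partialProd_succ, ih, hf.per, mul_assoc]
  | pred k ih =>
    have h := partialProd_succ (f := f) (-k - 1 + n)
    have h' := partialProd_succ (f := f) (-k - 1)
    rw [show -(k : ℤ) - 1 + n + 1 = -k + n by ring, ih, hf.per] at h
    rw [show -(k : ℤ) - 1 + 1 = -k by ring] at h'
    rw [h', ← mul_assoc] at h
    exact (mul_right_cancel h).symm

lemma partialProd_add_mul_period (hf : Cyc f n) (k a : ℤ) :
    partialProd f (k + a * n) = partialProd f n ^ a * partialProd f k := by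
  induction a with
  | zero => simp
  | succ a ih =>
    rw [show k + ((a : ℤ) + 1) * n = k + a * n + n by ring, hf.partialProd_add_period, ih,
      ← mul_assoc, ← zpow_one_add, add_comm]
  | pred a ih =>
    have h := hf.partialProd_add_period (k + (-(a : ℤ) - 1) * n)
    rw [show k + (-(a : ℤ) - 1) * n + n = k + -a * n by ring, ih] at h
    rw [eq_comm, ← eq_inv_mul_iff_mul_eq] at h
    rw [h, ← mul_assoc, ← zpow_neg_one, ← zpow_add]
    congr 2
    ring

lemma wordPerm_seg_period (hf : Cyc f n) (k : ℤ) :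
    wordPerm (seg f k n) = (partialProd f k)⁻¹ * partialProd f n * partialProd f k := by
  rw [mul_assoc, ← hf.partialProd_add_period, partialProd_add, inv_mul_cancel_left]

end Cyc

/-- The pairs of fixed points of the cyclic rotations of the period of a bi-infinite word. -/
structure Axis (f : ℤ → Letter) (n : ℕ) (ξ η : ℤ → ℝ) : Prop where
  mem_left : ∀ k, ξ k ∈ arc (f k)
  mem_right : ∀ k, η k ∈ arc (f (k - 1))
  step_left : ∀ k, refl (f k) (ξ (k + 1) : OnePoint ℝ) = ξ k
  step_right : ∀ k, refl (f k) (η (k + 1) : OnePoint ℝ) = η k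
  fix : ∀ k p, wordPerm (seg f k n) p = p ↔ p = ξ k ∨ p = η k

lemma Cyc.exists_axis {f : ℤ → Letter} {n : ℕ} (hf : Cyc f n) : ∃ ξ η, Axis f n ξ η := by
  obtain ⟨k₁, hk₁⟩ := hf.occ .y
  set k₀ := k₁ + 1 with hk₀
  obtain ⟨m, rfl⟩ : ∃ m, n = m + 2 := by
    obtain ⟨r, hr⟩ := hf.even
    have := hf.pos
    exact ⟨n - 2, by omega⟩
  have hseg : seg f k₀ (m + 2) = f k₀ :: (seg f (k₀ + 1) m ++ [.y]) := by
    rw [seg_succ', seg_succ]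
    congr 3
    rw [← hk₁]
    refine (hf.per k₁ ▸ ?_)
    congr 1
    push_cast
    ring
  obtain ⟨x, y, hx, hy, hfix⟩ := exists_fixed_of_halfLine (phiM (seg f k₀ (m + 2))) (by
    intro q hq
    rw [act_phiM _ (by rw [seg_length]; exact hf.even), hseg]
    refine wordPerm_halfLine ?_ ?_ ?_ hq
    · rw [← hseg]; exact seg_isChain hf.red _ _
    · rw [← hk₁]; exact (hf.red k₁).symm
    · intro b; rw [← hseg]; exact hf.mem_seg _ _)
  rw [act_phiM _ (by rw [seg_length]; exact hf.even)] at hfix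
  have hP : ∀ k q, refl (f k) ((partialProd f (k + 1))⁻¹ q) = (partialProd f k)⁻¹ q := by
    intro k q
    rw [partialProd_succ, mul_inv_rev, refl_inv, Equiv.Perm.mul_apply, refl_refl]
  have hP' : ∀ k q, (partialProd f (k + 1))⁻¹ q = refl (f k) ((partialProd f k)⁻¹ q) := by
    intro k q
    rw [← hP k, refl_refl]
  have hper : ∀ q k, wordPerm (seg f k₀ (m + 2)) q = q →
      (partialProd f (k + (m + 2 : ℕ)))⁻¹ (partialProd f k₀ q) =
        (partialProd f k)⁻¹ (partialProd f k₀ q) := by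
    intro q k hq
    rw [hf.wordPerm_seg_period] at hq
    simp only [Equiv.Perm.mul_apply, Equiv.Perm.inv_eq_iff_eq] at hq
    rw [hf.partialProd_add_period, mul_inv_rev, Equiv.Perm.mul_apply]
    congr 1
    rw [Equiv.Perm.inv_eq_iff_eq, hq]
  have hperx : ∀ (q : OnePoint ℝ) (k a : ℤ), wordPerm (seg f k₀ (m + 2)) q = q →
      (partialProd f (k + a * (m + 2 : ℕ)))⁻¹ (partialProd f k₀ q) =
        (partialProd f k)⁻¹ (partialProd f k₀ q) := by
    intro q k a hq
    induction a with
    | zero => simp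
    | succ a ih => rw [← ih, ← hper q (k + a * _) hq]; congr 3; ring
    | pred a ih => rw [← ih, ← hper q (k + (-a - 1) * _) hq]; congr 3; ring
  have hm : (0 : ℤ) < (m + 2 : ℕ) := by positivity
  have hξ : ∀ k, ∃ t ∈ arc (f k), (partialProd f k)⁻¹ (partialProd f k₀ x) = (t : OnePoint ℝ) := by
    have hneg : ∀ j : ℕ, ∃ t ∈ arc (f (k₁ - j)),
        (partialProd f (k₁ - j))⁻¹ (partialProd f k₀ x) = (t : OnePoint ℝ) := by
      intro j
      induction j with
      | zero =>
        refine ⟨-x, by simpa [hk₁, arc] using hx, ?_⟩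
        rw [Nat.cast_zero, sub_zero, ← hP, ← hk₀, hk₁, inv_perm_apply, refl_coe]
        simp [reflR]
      | succ j ih =>
        obtain ⟨t, ht, e⟩ := ih
        have hne := hf.red (k₁ - (j + 1 : ℕ))
        rw [← hP, show k₁ - ((j + 1 : ℕ) : ℤ) + 1 = k₁ - j by push_cast; ring, e]
        rw [show k₁ - ((j + 1 : ℕ) : ℤ) + 1 = k₁ - j by push_cast; ring] at hne
        exact ⟨_, reflR_mem hne ht, refl_coe_of_mem hne ht⟩
    intro k
    obtain ⟨j, a, hj⟩ : ∃ (j : ℕ) (a : ℤ), k₁ - j = k + a * (m + 2 : ℕ) := by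
      refine ⟨((k₁ - k) % (m + 2 : ℕ)).toNat, (k₁ - k) / (m + 2 : ℕ), ?_⟩
      rw [Int.toNat_of_nonneg (Int.emod_nonneg _ hm.ne')]
      linarith [Int.emod_add_mul_ediv (k₁ - k) (m + 2 : ℕ)]
    have := hneg j
    rwa [hj, hf.per_mul, hperx _ _ _ ((hfix _).2 (Or.inl rfl))] at this
  have hη : ∀ k, ∃ t ∈ arc (f (k - 1)),
      (partialProd f k)⁻¹ (partialProd f k₀ y) = (t : OnePoint ℝ) := by
    have hpos : ∀ j : ℕ, ∃ t ∈ arc (f (k₀ + j - 1)),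
        (partialProd f (k₀ + j))⁻¹ (partialProd f k₀ y) = (t : OnePoint ℝ) := by
      intro j
      induction j with
      | zero =>
        refine ⟨y, ?_, by simp⟩
        rw [Nat.cast_zero, add_zero, hk₀, add_sub_cancel_right, hk₁]
        exact hy
      | succ j ih =>
        obtain ⟨t, ht, e⟩ := ih
        have hne := (hf.red (k₀ + j - 1)).symm
        rw [sub_add_cancel] at hne
        rw [Nat.cast_succ, ← add_assoc, add_sub_cancel_right, hP', e]
        exact ⟨_, reflR_mem hne ht, refl_coe_of_mem hne ht⟩
    intro k
    obtain ⟨j, a, hj⟩ : ∃ (j : ℕ) (a : ℤ), k₀ + j = k + a * (m + 2 : ℕ) := by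
      refine ⟨((k - k₀) % (m + 2 : ℕ)).toNat, -((k - k₀) / (m + 2 : ℕ)), ?_⟩
      rw [Int.toNat_of_nonneg (Int.emod_nonneg _ hm.ne')]
      linarith [Int.emod_add_mul_ediv (k - k₀) (m + 2 : ℕ)]
    have := hpos j
    rwa [hj, add_sub_right_comm, hf.per_mul, hperx _ _ _ ((hfix _).2 (Or.inr rfl))] at this
  choose ξ hξ₁ hξ₂ using hξ
  choose η hη₁ hη₂ using hη
  refine ⟨ξ, η, hξ₁, hη₁, fun k => ?_, fun k => ?_, fun k p => ?_⟩
  · rw [← hξ₂, ← hξ₂, hP]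
  · rw [← hη₂, ← hη₂, hP]
  · have h := hfix ((partialProd f k₀)⁻¹ (partialProd f k p))
    rw [hf.wordPerm_seg_period] at h
    simp only [Equiv.Perm.mul_apply, perm_apply_inv, EmbeddingLike.apply_eq_iff_eq,
      Equiv.Perm.inv_eq_iff_eq] at h
    rw [← hξ₂, ← hη₂, hf.wordPerm_seg_period, Equiv.Perm.eq_inv_iff_eq, Equiv.Perm.eq_inv_iff_eq]
    simpa only [Equiv.Perm.mul_apply, Equiv.Perm.inv_eq_iff_eq] using h

/-! ### Translations and reflections of a cyclic word -/

namespace Cyc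

variable {f : ℤ → Letter} {n : ℕ}

lemma exists_nat_add_mul (hf : Cyc f n) (i : ℤ) : ∃ (j : ℕ) (a : ℤ), (j : ℤ) = i + a * n := by
  have hn : (1 : ℤ) ≤ n := by exact_mod_cast hf.pos
  refine ⟨(i + |i| * n).toNat, |i|, Int.toNat_of_nonneg ?_⟩
  have h1 := neg_abs_le i
  have h2 := abs_nonneg i
  nlinarith

lemma dvd_of_forall_add (hf : Cyc f n) {k l : ℤ} (h : ∀ j : ℕ, f (k + j) = f (l + j)) :
    (n : ℤ) ∣ l - k := by
  refine hf.aper _ fun i => ?_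
  obtain ⟨j, a, hj⟩ := hf.exists_nat_add_mul (i - k)
  have := h j
  rw [hj, show k + (i - k + a * n) = i + a * n by ring,
    show l + (i - k + a * n) = i + (l - k) + a * n by ring, hf.per_mul, hf.per_mul] at this
  exact this.symm

lemma dvd_of_forall_sub (hf : Cyc f n) {k l : ℤ} (h : ∀ j : ℕ, f (k - j) = f (l - j)) :
    (n : ℤ) ∣ l - k := by
  refine hf.aper _ fun i => ?_
  obtain ⟨j, a, hj⟩ := hf.exists_nat_add_mul (k - i)
  have := h j
  rw [hj, show k - (k - i + a * n) = i + -a * n by ring,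
    show l - (k - i + a * n) = i + (l - k) + -a * n by ring, hf.per_mul, hf.per_mul] at this
  exact this.symm

lemma exists_ne_of_even (hf : Cyc f n) {k l : ℤ} (hkl : (k - l) % 2 = 0) :
    ∃ j : ℕ, f (k - 1 - j) ≠ f (l + j) := by
  by_contra! h
  obtain ⟨j, a, hj⟩ := hf.exists_nat_add_mul ((k - l) / 2 - 1)
  have := h j
  rw [hj, show k - 1 - ((k - l) / 2 - 1 + a * n) = (l + (k - l) / 2 - 1) + 1 + -a * n by
    have := Int.ediv_mul_cancel (Int.dvd_of_emod_eq_zero hkl); linarith,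
    show l + ((k - l) / 2 - 1 + a * n) = (l + (k - l) / 2 - 1) + a * n by ring, hf.per_mul,
    hf.per_mul] at this
  exact hf.red _ this.symm

end Cyc

lemma partialProd_eq_wordPerm (f : ℤ → Letter) (k : ℤ) :
    ∃ u : List Letter, u.length = k.natAbs ∧ partialProd f k = wordPerm u := by
  rcases k with m | m
  · exact ⟨_, by simp, rfl⟩
  · exact ⟨_, by simp, rfl⟩

lemma linked_refl_iff (a : Letter) (p₁ p₂ q₁ q₂ : OnePoint ℝ) :
    Linked {refl a p₁, refl a p₂} {refl a q₁, refl a q₂} ↔ Linked {p₁, p₂} {q₁, q₂} := by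
  have := linked_image_iff (reflHomeo a) {p₁, p₂} q₁ q₂
  rwa [image_pair] at this

lemma linked_wordPerm_iff (u : List Letter) (p₁ p₂ q₁ q₂ : OnePoint ℝ) :
    Linked {wordPerm u p₁, wordPerm u p₂} {wordPerm u q₁, wordPerm u q₂} ↔
      Linked {p₁, p₂} {q₁, q₂} := by
  induction u with
  | nil => rfl
  | cons a t ih => simpa [linked_refl_iff] using ih

lemma linked_partialProd_iff (f : ℤ → Letter) (k : ℤ) (p₁ p₂ q₁ q₂ : OnePoint ℝ) :
    Linked {partialProd f k p₁, partialProd f k p₂} {partialProd f k q₁, partialProd f k q₂} ↔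
      Linked {p₁, p₂} {q₁, q₂} := by
  obtain ⟨u, -, h⟩ := partialProd_eq_wordPerm f k
  rw [h, linked_wordPerm_iff]

/-! ### Decomposition of group elements along the axis -/

lemma exists_reduced (t : List Letter) : ∃ s : List Letter, s.IsChain (· ≠ ·) ∧
    wordPerm s = wordPerm t ∧ s.length % 2 = t.length % 2 := by
  induction t with
  | nil => exact ⟨[], by simp, rfl, rfl⟩
  | cons a t ih =>
    obtain ⟨s, h₁, h₂, h₃⟩ := ih
    rcases s with _ | ⟨b, s⟩
    · exact ⟨[a], by simp, by rw [wordPerm_cons, wordPerm_cons, h₂],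
        by simp only [List.length_cons, List.length_nil] at *; omega⟩
    · by_cases hab : a = b
      · subst hab
        refine ⟨s, h₁.of_cons, ?_, by simp only [List.length_cons] at *; omega⟩
        rw [wordPerm_cons, ← h₂, wordPerm_cons, ← mul_assoc, refl_mul_self, one_mul]
      · refine ⟨a :: b :: s, List.isChain_cons_cons.2 ⟨hab, h₁⟩, by rw [wordPerm_cons, h₂,
          wordPerm_cons], by simp only [List.length_cons] at *; omega⟩

lemma partialProd_pred {f : ℤ → Letter} (k : ℤ) :
    partialProd f (k - 1) = partialProd f k * refl (f (k - 1)) := by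
  have := partialProd_succ (f := f) (k - 1)
  rw [sub_add_cancel] at this
  rw [this, mul_assoc, refl_mul_self, mul_one]

namespace Axis

variable {f : ℤ → Letter} {n : ℕ} {ξ η : ℤ → ℝ}

lemma partialProd_left (A : Axis f n ξ η) (k : ℤ) :
    partialProd f k (ξ k : OnePoint ℝ) = ξ 0 := by
  induction k with
  | zero => simp
  | succ k ih => rw [partialProd_succ, Equiv.Perm.mul_apply, A.step_left, ih]
  | pred k ih =>
    rw [partialProd_pred, Equiv.Perm.mul_apply, ← A.step_left, refl_refl, sub_add_cancel, ih]

lemma partialProd_right (A : Axis f n ξ η) (k : ℤ) :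
    partialProd f k (η k : OnePoint ℝ) = η 0 := by
  induction k with
  | zero => simp
  | succ k ih => rw [partialProd_succ, Equiv.Perm.mul_apply, A.step_right, ih]
  | pred k ih =>
    rw [partialProd_pred, Equiv.Perm.mul_apply, ← A.step_right, refl_refl, sub_add_cancel, ih]

lemma decomp (A : Axis f n ξ η) {t : List Letter} (ht : t.IsChain (· ≠ ·)) (k l : ℤ) :
    (∃ k' l', partialProd f k * wordPerm t * (partialProd f l)⁻¹ =
        partialProd f k' * (partialProd f l')⁻¹ ∧ (k' - l' - (k - l) - t.length) % 2 = 0) ∨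
      ∃ k' e, e ≠ f k' ∧ e ≠ f (k' - 1) ∧
        (∃ s ∈ arc e, (partialProd f k * wordPerm t * (partialProd f l)⁻¹) (ξ 0) =
          partialProd f k' (s : OnePoint ℝ)) ∧
        (∃ s ∈ arc e, (partialProd f k * wordPerm t * (partialProd f l)⁻¹) (η 0) =
          partialProd f k' (s : OnePoint ℝ)) := by
  induction hN : t.length using Nat.strong_induction_on generalizing t k l with
  | _ N ih =>
    subst hN
    rcases t.eq_nil_or_concat with rfl | ⟨t₁, e', ht₁⟩
    · exact Or.inl ⟨k, l, by simp, by simp⟩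
    obtain ⟨e, t₂, ht₂⟩ := List.exists_cons_of_ne_nil (l := t) (by simp [ht₁])
    have hc₂ : t₂.IsChain (· ≠ ·) := by rw [ht₂] at ht; exact ht.of_cons
    have hc₁ : t₁.IsChain (· ≠ ·) := by
      rw [ht₁, List.concat_eq_append, List.isChain_append] at ht; exact ht.1
    have hl₁ : t.length = t₁.length + 1 := by simp [ht₁]
    have hl₂ : t.length = t₂.length + 1 := by simp [ht₂]
    have hw₁ : wordPerm t = wordPerm t₁ * refl e' := by simp [ht₁]
    have hw₂ : wordPerm t = refl e * wordPerm t₂ := by simp [ht₂]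
    by_cases h1 : e = f k
    · have hP : partialProd f k * wordPerm t = partialProd f (k + 1) * wordPerm t₂ := by
        rw [hw₂, partialProd_succ, h1, mul_assoc]
      have := ih t₂.length (by omega) hc₂ (k + 1) l rfl
      rw [hP]
      refine this.imp ?_ id
      rintro ⟨k', l', e, h⟩
      exact ⟨k', l', e, by omega⟩
    by_cases h2 : e = f (k - 1)
    · have hP : partialProd f k * wordPerm t = partialProd f (k - 1) * wordPerm t₂ := by
        rw [hw₂, partialProd_pred, h2, mul_assoc]
      have := ih t₂.length (by omega) hc₂ (k - 1) l rfl
      rw [hP]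
      refine this.imp ?_ id
      rintro ⟨k', l', e, h⟩
      exact ⟨k', l', e, by omega⟩
    by_cases h3 : e' = f l
    · have hP : partialProd f k * wordPerm t * (partialProd f l)⁻¹ =
          partialProd f k * wordPerm t₁ * (partialProd f (l + 1))⁻¹ := by
        rw [hw₁, partialProd_succ, h3, mul_inv_rev, refl_inv, mul_assoc, mul_assoc, mul_assoc]
      have := ih t₁.length (by omega) hc₁ k (l + 1) rfl
      rw [hP]
      refine this.imp ?_ id
      rintro ⟨k', l', e, h⟩
      exact ⟨k', l', e, by omega⟩
    by_cases h4 : e' = f (l - 1)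
    · have hP : partialProd f k * wordPerm t * (partialProd f l)⁻¹ =
          partialProd f k * wordPerm t₁ * (partialProd f (l - 1))⁻¹ := by
        rw [hw₁, partialProd_pred, h4, mul_inv_rev, refl_inv, mul_assoc, mul_assoc, mul_assoc]
      have := ih t₁.length (by omega) hc₁ k (l - 1) rfl
      rw [hP]
      refine this.imp ?_ id
      rintro ⟨k', l', e, h⟩
      exact ⟨k', l', e, by omega⟩
    right
    have hcc : ∀ c, e' ≠ c → (e :: (t₂ ++ [c])).IsChain (· ≠ ·) := by
      intro c hc
      rw [← List.cons_append, ← ht₂, List.isChain_append]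
      refine ⟨ht, by simp, ?_⟩
      simpa [ht₁] using hc
    refine ⟨k, e, h1, h2, ?_, ?_⟩
    · obtain ⟨s, hs, he⟩ := wordPerm_mem_arc (hcc _ h3) (A.mem_left l)
      refine ⟨s, hs, ?_⟩
      rw [Equiv.Perm.mul_apply, Equiv.Perm.mul_apply, ← A.partialProd_left l, inv_perm_apply, ht₂,
        he]
    · obtain ⟨s, hs, he⟩ := wordPerm_mem_arc (hcc _ h4) (A.mem_right l)
      refine ⟨s, hs, ?_⟩
      rw [Equiv.Perm.mul_apply, Equiv.Perm.mul_apply, ← A.partialProd_right l, inv_perm_apply, ht₂,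
        he]

lemma decomp_of_mem_Gamma (A : Axis f n ξ η) {h : SL2Z} (hh : h ∈ Gamma) :
    (∃ k l, act h = partialProd f k * (partialProd f l)⁻¹ ∧ (k - l) % 2 = 0) ∨
      ∃ k e, e ≠ f k ∧ e ≠ f (k - 1) ∧
        (∃ s ∈ arc e, act h (ξ 0) = partialProd f k (s : OnePoint ℝ)) ∧
        (∃ s ∈ arc e, act h (η 0) = partialProd f k (s : OnePoint ℝ)) := by
  obtain ⟨u, hu, e⟩ := exists_word_of_mem_Gamma hh
  obtain ⟨t, ht, e', hl⟩ := exists_reduced u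
  have := A.decomp ht 0 0
  simp only [partialProd_zero, one_mul, inv_one, mul_one, e', ← e] at this
  refine this.imp ?_ id
  rintro ⟨k, l, h₁, h₂⟩
  obtain ⟨r, hr⟩ := hu
  exact ⟨k, l, h₁, by omega⟩

end Axis

lemma Cyc.partialProd_ne_one {f : ℤ → Letter} {n : ℕ} (hf : Cyc f n) {k : ℤ} (hk : k ≠ 0) :
    partialProd f k ≠ 1 := by
  have key : ∀ (l : ℤ) (m : ℕ), partialProd f l = partialProd f (l + m) → m = 0 := by
    intro l m h
    rw [partialProd_add, left_eq_mul] at h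
    rw [← seg_length (f := f) l m, eq_nil_of_wordPerm_eq_one (seg_isChain hf.red _ _) h]
    rfl
  intro h
  rcases lt_or_gt_of_ne hk with hk | hk
  · have := key k k.natAbs (by rw [h, show k + k.natAbs = 0 by omega, partialProd_zero])
    omega
  · have := key 0 k.natAbs (by rw [show (0 : ℤ) + k.natAbs = k by omega, h, partialProd_zero])
    omega

lemma exists_mem_Gamma_partialProd (f : ℤ → Letter) {k l : ℤ} (hkl : (k - l) % 2 = 0) :
    ∃ h : Gamma, act h = partialProd f k * (partialProd f l)⁻¹ := by
  obtain ⟨u, hu, e⟩ := partialProd_eq_wordPerm f k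
  obtain ⟨u', hu', e'⟩ := partialProd_eq_wordPerm f l
  refine ⟨⟨phiM (u ++ u'.reverse), phiM_mem _⟩, ?_⟩
  rw [act_phiM, wordPerm_append, wordPerm_reverse, e, e']
  rw [List.length_append, List.length_reverse, hu, hu', Nat.even_iff]
  omega

/-! ### Crossing of rays -/

/-- Two rays of letters cross: they start with different letters, agree on a nonempty interval
starting at position `1`, and diverge at position `d` on the side opposite to their start. -/
def Cross (ρ σ : ℕ → Letter) : Prop :=
  ρ 0 ≠ σ 0 ∧ ∃ d, 2 ≤ d ∧ (∀ j, 1 ≤ j → j < d → ρ j = σ j) ∧ ρ d ≠ σ d ∧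
    ((ρ 1 = nextL (ρ 0) ↔ ρ d = nextL (ρ (d - 1))) ↔ Even d)

/-- The forward ray of a bi-infinite word. -/
def fwd (f : ℤ → Letter) (k : ℤ) : ℕ → Letter := fun j => f (k - 1 + j)

/-- The backward ray of a bi-infinite word. -/
def bwd (f : ℤ → Letter) (l : ℤ) : ℕ → Letter := fun j => f (l - j)

lemma cross_iff_of_ne {ρ σ : ℕ → Letter} {d : ℕ} (h0 : ρ 0 ≠ σ 0) (hd : 2 ≤ d)
    (he : ∀ j, 1 ≤ j → j < d → ρ j = σ j) (hne : ρ d ≠ σ d) :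
    Cross ρ σ ↔ ((ρ 1 = nextL (ρ 0) ↔ ρ d = nextL (ρ (d - 1))) ↔ Even d) := by
  refine ⟨fun ⟨_, d', h1, h2, h3, h4⟩ => ?_, fun h => ⟨h0, d, hd, he, hne, h⟩⟩
  obtain rfl : d' = d := by
    rcases lt_trichotomy d' d with h | h | h
    · exact absurd (he d' (by omega) h) h3
    · exact h
    · exact absurd (h2 d (by omega) h) hne
  exact h4

lemma Cross.one_eq {ρ σ : ℕ → Letter} (h : Cross ρ σ) : ρ 1 = σ 1 := by
  obtain ⟨_, d, h1, h2, _⟩ := h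
  exact h2 1 le_rfl (by omega)

/-- Comparison of two boundary points in terms of the first letter at which their expansions
differ. -/
lemma lt_iff_of_agree (d : ℕ) : ∀ {ρ σ : ℕ → Letter} {x y : ℕ → ℝ}
    (_ : ∀ j, ρ j ≠ ρ (j + 1)) (_ : ∀ j, σ j ≠ σ (j + 1))
    (_ : ∀ j, x j ∈ arc (ρ j)) (_ : ∀ j, y j ∈ arc (σ j))
    (_ : ∀ j, refl (ρ j) (x (j + 1) : OnePoint ℝ) = x j)
    (_ : ∀ j, refl (σ j) (y (j + 1) : OnePoint ℝ) = y j)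
    (_ : ∀ j ≤ d, ρ j = σ j) (_ : ρ (d + 1) ≠ σ (d + 1)),
    x 0 ≠ y 0 ∧ (y 0 < x 0 ↔ (ρ (d + 1) = nextL (ρ d) ↔ Even d)) := by
  induction d with
  | zero =>
    intro ρ σ x y hρ hσ hx hy sx sy he hne
    have e0 := he 0 le_rfl
    have h1 := hρ 0
    have h2 := e0 ▸ hσ 0
    simp only [zero_add] at *
    have ex := sx 0
    have ey := sy 0
    rw [zero_add, refl_coe_of_mem h1 (by simpa using hx 1), OnePoint.coe_eq_coe] at ex
    rw [zero_add, ← e0, refl_coe_of_mem h2 (by simpa using hy 1), OnePoint.coe_eq_coe] at ey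
    refine ⟨fun h => hne ?_, ?_⟩
    · have : refl (ρ 0) (x 1 : OnePoint ℝ) = refl (ρ 0) (y 1) := by
        have a1 := sx 0
        have a2 := sy 0
        rw [zero_add] at a1 a2
        rw [a1, e0, a2, h]
      have := (refl (ρ 0)).injective this
      rw [OnePoint.coe_eq_coe] at this
      exact arc_disjoint (hx 1) (this ▸ hy 1)
    · rw [← ex, ← ey, reflR_lt_iff_of_ne h1 h2 hne (hx 1) (hy 1)]
      simp
  | succ d ih =>
    intro ρ σ x y hρ hσ hx hy sx sy he hne
    obtain ⟨i1, i2⟩ := ih (ρ := fun j => ρ (j + 1)) (σ := fun j => σ (j + 1))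
      (x := fun j => x (j + 1)) (y := fun j => y (j + 1)) (fun j => hρ _) (fun j => hσ _)
      (fun j => hx _) (fun j => hy _) (fun j => sx _) (fun j => sy _)
      (fun j hj => he _ (by omega)) hne
    simp only [zero_add] at i1 i2
    have e0 := he 0 (by omega)
    have e1 := he 1 (by omega)
    have h1 := hρ 0
    have ex := sx 0
    have ey := sy 0
    have hy1 := hy 1
    simp only [zero_add] at *
    rw [← e1] at hy1
    have ex' := ex
    have ey' := ey
    rw [refl_coe_of_mem h1 (hx 1), OnePoint.coe_eq_coe] at ex
    rw [← e0, refl_coe_of_mem h1 hy1, OnePoint.coe_eq_coe] at ey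
    refine ⟨fun h => i1 ?_, ?_⟩
    · have : refl (ρ 0) (x 1 : OnePoint ℝ) = refl (ρ 0) (y 1) := by
        rw [ex', e0, ey', h]
      have := (refl (ρ 0)).injective this
      rwa [OnePoint.coe_eq_coe] at this
    · have h3 : x 1 < y 1 ↔ ¬ y 1 < x 1 :=
        ⟨fun h => h.not_gt, fun h => lt_of_le_of_ne (not_lt.1 h) i1⟩
      rw [← ex, ← ey, reflR_lt_iff_of_eq h1 (hx 1) hy1, h3, i2, Nat.even_add_one]
      tauto

/-- The side conditions characterizing the first point at which two axes meet. -/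
def Apart (f : ℤ → Letter) (k l : ℤ) : Prop := f (k - 1) ≠ f (l - 1) ∧ f (k - 1) ≠ f l

/-- The forward ray at `k` crosses the forward or the backward ray at `l`. -/
def CrossAt (f : ℤ → Letter) (k l : ℤ) : Prop :=
  Cross (fwd f k) (fwd f l) ∨ Cross (fwd f k) (bwd f l)

lemma letter_cases {a b c d : Letter} (h1 : a ≠ b) (h2 : a ≠ c) (h3 : b ≠ c) (h4 : d ≠ a) :
    d = b ∨ d = c := by
  cases a <;> cases b <;> cases c <;> cases d <;> simp_all

lemma CrossAt.apart {f : ℤ → Letter} (hf : ∀ k, f k ≠ f (k + 1)) {k l : ℤ}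
    (h : CrossAt f k l) : Apart f k l := by
  have hk := hf (k - 1)
  have hl := hf (l - 1)
  rw [sub_add_cancel] at hk hl
  rcases h with h | h
  · have h0 := h.1
    have h1 := h.one_eq
    simp [fwd] at h0 h1
    exact ⟨h0, h1 ▸ hk⟩
  · have h0 := h.1
    have h1 := h.one_eq
    simp [fwd, bwd] at h0 h1
    exact ⟨h1 ▸ hk, h0⟩

/-- The two ends of an axis, seen from position `k`. -/
def ends (ξ η : ℤ → ℝ) (k : ℤ) : Set (OnePoint ℝ) := {(ξ k : OnePoint ℝ), (η k : OnePoint ℝ)}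

lemma linked_iff_cross {ρ σ : ℕ → Letter} {x y : ℕ → ℝ} {p q : ℝ}
    (hρ : ∀ j, ρ j ≠ ρ (j + 1)) (hσ : ∀ j, σ j ≠ σ (j + 1))
    (hx : ∀ j, x j ∈ arc (ρ (j + 1))) (hy : ∀ j, y j ∈ arc (σ (j + 1)))
    (sx : ∀ j, refl (ρ (j + 1)) (x (j + 1) : OnePoint ℝ) = x j)
    (sy : ∀ j, refl (σ (j + 1)) (y (j + 1) : OnePoint ℝ) = y j)
    (hp : p ∈ arc (ρ 0)) (hq : q ∈ arc (σ 0)) (h0 : ρ 0 ≠ σ 0) (h1 : ρ 1 = σ 1)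
    (hex : ∃ j, ρ (j + 1) ≠ σ (j + 1)) :
    Linked {(x 0 : OnePoint ℝ), (p : OnePoint ℝ)} {(y 0 : OnePoint ℝ), (q : OnePoint ℝ)} ↔
      Cross ρ σ := by
  obtain ⟨d, hd⟩ : ∃ d, Nat.find hex = d + 1 := by
    refine Nat.exists_eq_succ_of_ne_zero fun h => ?_
    have := Nat.find_spec hex
    rw [h] at this
    exact this h1
  have hne := Nat.find_spec hex
  have hlt : ∀ j ≤ d, ρ (j + 1) = σ (j + 1) := fun j hj =>
    not_not.1 (Nat.find_min hex (m := j) (by omega))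
  rw [hd] at hne
  obtain ⟨k1, k2⟩ := lt_iff_of_agree d (fun j => hρ (j + 1)) (fun j => hσ (j + 1)) hx hy sx sy
    hlt hne
  have hy0 := hy 0
  rw [zero_add, ← h1] at hy0
  rw [linked_arc_iff (hρ 0) h0 (h1 ▸ (hσ 0).symm) hp (hx 0) hq hy0 k1, k2,
    cross_iff_of_ne (d := d + 2) h0 (by omega)
      (fun j hj1 hj2 => by
        have := hlt (j - 1) (by omega)
        rwa [Nat.sub_add_cancel hj1] at this) hne]
  simp only [Nat.even_add, zero_add, Nat.add_succ_sub_one]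
  have : Even 2 := even_two
  tauto

lemma fwd_succ (f : ℤ → Letter) (k : ℤ) (j : ℕ) : fwd f k (j + 1) = f (k + j) := by
  simp only [fwd]; congr 1; push_cast; ring

lemma bwd_succ (f : ℤ → Letter) (l : ℤ) (j : ℕ) : bwd f l (j + 1) = f (l - 1 - j) := by
  simp only [bwd]; congr 1; push_cast; ring

lemma fwd_ne {f : ℤ → Letter} (hf : ∀ k, f k ≠ f (k + 1)) (k : ℤ) (j : ℕ) :
    fwd f k j ≠ fwd f k (j + 1) := by
  have := hf (k - 1 + j)
  rw [fwd_succ]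
  rwa [show k - 1 + (j : ℤ) + 1 = k + j by ring] at this

lemma bwd_ne {f : ℤ → Letter} (hf : ∀ k, f k ≠ f (k + 1)) (l : ℤ) (j : ℕ) :
    bwd f l j ≠ bwd f l (j + 1) := by
  have := hf (l - 1 - j)
  rw [bwd_succ]
  rw [show l - 1 - (j : ℤ) + 1 = l - j by ring] at this
  exact this.symm

lemma Axis.linked_iff {f : ℤ → Letter} {n : ℕ} {ξ η : ℤ → ℝ} (hf : Cyc f n) (A : Axis f n ξ η)
    {k l : ℤ} (hkl : (k - l) % 2 = 0) (ha : Apart f k l) :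
    Linked (ends ξ η k) (ends ξ η l) ↔ CrossAt f k l := by
  obtain ⟨h1, h2⟩ := ha
  have hk := hf.red (k - 1)
  have hl := hf.red (l - 1)
  rw [sub_add_cancel] at hk hl
  have hxk : ∀ j : ℕ, ξ (k + j) ∈ arc (fwd f k (j + 1)) := fun j => by
    rw [fwd_succ]; exact A.mem_left _
  have hsk : ∀ j : ℕ, refl (fwd f k (j + 1)) (ξ (k + (j + 1 : ℕ)) : OnePoint ℝ) = ξ (k + j) :=
    fun j => by
      rw [fwd_succ]; push_cast; rw [← add_assoc]; exact A.step_left _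
  have hpk : η k ∈ arc (fwd f k 0) := by simpa [fwd] using A.mem_right k
  rcases letter_cases h1 h2 hl hk.symm with e | e
  · have hB : ¬ Cross (fwd f k) (fwd f l) := fun h => by
      have := h.one_eq
      simp only [fwd_succ f _ 0, Nat.cast_zero, add_zero] at this
      exact hl (by rw [← e, this])
    have key := linked_iff_cross (ρ := fwd f k) (σ := bwd f l) (x := fun j => ξ (k + j))
      (y := fun j => η (l - j)) (p := η k) (q := ξ l) (fwd_ne hf.red k) (bwd_ne hf.red l) hxk
      (fun j => by
        rw [bwd_succ]
        have := A.mem_right (l - j)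
        rwa [sub_right_comm] at this) hsk
      (fun j => by
        have := A.step_right (l - 1 - j)
        rw [show l - 1 - (j : ℤ) + 1 = l - j by ring] at this
        rw [bwd_succ, Nat.cast_add, Nat.cast_one, show l - ((j : ℤ) + 1) = l - 1 - j by ring,
          ← this, refl_refl])
      hpk (by simpa [bwd] using A.mem_left l) (by simpa [fwd, bwd] using h2)
      (by simpa [fwd, bwd] using e)
      (by
        obtain ⟨j, hj⟩ := hf.exists_ne_of_even (k := l) (l := k) (by omega)
        exact ⟨j, by rw [fwd_succ, bwd_succ]; exact hj.symm⟩)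
    simp only [Nat.cast_zero, add_zero, sub_zero] at key
    rw [ends, ends, pair_comm (ξ l : OnePoint ℝ), key, CrossAt, or_iff_right hB]
  · have hB : ¬ Cross (fwd f k) (bwd f l) := fun h => by
      have := h.one_eq
      simp only [fwd_succ f _ 0, bwd_succ f _ 0, Nat.cast_zero, add_zero, sub_zero] at this
      exact hl (by rw [← e, this])
    have key := linked_iff_cross (ρ := fwd f k) (σ := fwd f l) (x := fun j => ξ (k + j))
      (y := fun j => ξ (l + j)) (p := η k) (q := η l) (fwd_ne hf.red k) (fwd_ne hf.red l) hxk
      (fun j => by rw [fwd_succ]; exact A.mem_left _) hsk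
      (fun j => by rw [fwd_succ]; push_cast; rw [← add_assoc]; exact A.step_left _)
      hpk (by simpa [fwd] using A.mem_right l) (by simpa [fwd] using h1)
      (by simpa [fwd] using e)
      (by
        by_contra! h
        refine h1 (hf.per_of_dvd ?_).symm
        have := hf.dvd_of_forall_add (k := k) (l := l) fun j => by
          have := h j
          rwa [fwd_succ, fwd_succ] at this
        rwa [sub_sub_sub_cancel_right])
    simp only [Nat.cast_zero, add_zero] at key
    rw [ends, ends, key, CrossAt, or_iff_left hB]

/-! ### Good conjugates and linking of translated axes -/

lemma Hyperbolic.conj {g h : SL2Z} (hg : Hyperbolic g) : Hyperbolic (h * g * h⁻¹) := by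
  have : Matrix.trace ((h * g * h⁻¹ : SL2Z) : Matrix (Fin 2) (Fin 2) ℤ) =
      Matrix.trace (g : Matrix (Fin 2) (Fin 2) ℤ) := by
    rw [Matrix.SpecialLinearGroup.coe_mul, Matrix.trace_mul_comm,
      ← Matrix.SpecialLinearGroup.coe_mul, ← mul_assoc, inv_mul_cancel, one_mul]
  unfold Hyperbolic
  rwa [this]

lemma fixedSet_conj (g h : SL2Z) : fixedSet (h * g * h⁻¹) = act h '' fixedSet g := by
  ext p
  rw [mem_fixedSet, map_mul, map_mul, map_inv, Equiv.Perm.mul_apply, Equiv.Perm.mul_apply]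
  constructor
  · intro e
    refine ⟨(act h)⁻¹ p, ?_, perm_apply_inv _ _⟩
    rw [mem_fixedSet]
    conv_rhs => rw [← e]
    rw [inv_perm_apply]
  · rintro ⟨q, hq, rfl⟩
    rw [mem_fixedSet] at hq
    rw [inv_perm_apply, hq]

section

variable {f : ℤ → Letter} {n : ℕ} {ξ η : ℤ → ℝ}

namespace Axis

lemma ne (hf : Cyc f n) (A : Axis f n ξ η) (k : ℤ) : ξ k ≠ η k := fun h => by
  have h1 := A.mem_left k
  have h2 := A.mem_right k
  rw [h] at h1
  have := hf.red (k - 1)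
  rw [sub_add_cancel] at this
  exact this (arc_disjoint h2 h1)

lemma act_fix (A : Axis f n ξ η) {v : SL2Z} (hv : act v = partialProd f n) (p : OnePoint ℝ) :
    act v p = p ↔ p = ξ 0 ∨ p = η 0 := by
  have : partialProd f n = wordPerm (seg f 0 n) := by
    have := partialProd_add (f := f) 0 n
    rwa [zero_add, partialProd_zero, one_mul] at this
  rw [hv, this, A.fix]

lemma fixedSet_eq (A : Axis f n ξ η) {v : SL2Z} (hv : act v = partialProd f n) :
    fixedSet v = ends ξ η 0 := by
  ext p
  rw [mem_fixedSet, A.act_fix hv]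
  rfl

lemma goodConj_iff (hf : Cyc f n) (A : Axis f n ξ η) {v : Gamma}
    (hv : act v = partialProd f n) (h : Gamma) :
    GoodConj v h ↔ Linked (ends ξ η 0) {act h (ξ 0), act h (η 0)} := by
  have hyp : Hyperbolic (v : SL2Z) := hyperbolic_of_fixedSet (A.ne hf 0) (A.act_fix hv)
  have e : fixedSet ((h * v * h⁻¹ : Gamma) : SL2Z) =
      {act (h : SL2Z) (ξ 0), act (h : SL2Z) (η 0)} := by
    push_cast
    rw [fixedSet_conj, A.fixedSet_eq hv, ends, image_pair]
  unfold GoodConj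
  rw [e, A.fixedSet_eq hv]
  refine ⟨fun h => h.2.2, fun hl => ⟨hyp, ?_, hl⟩⟩
  push_cast
  exact Hyperbolic.conj hyp

lemma ends_zero (A : Axis f n ξ η) (k : ℤ) :
    ends ξ η 0 = {partialProd f k (ξ k), partialProd f k (η k)} := by
  rw [A.partialProd_left, A.partialProd_right, ends]

lemma inv_partialProd_left (A : Axis f n ξ η) (k : ℤ) :
    (partialProd f k)⁻¹ (ξ 0 : OnePoint ℝ) = ξ k := by
  rw [← A.partialProd_left k, inv_perm_apply]

lemma inv_partialProd_right (A : Axis f n ξ η) (k : ℤ) :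
    (partialProd f k)⁻¹ (η 0 : OnePoint ℝ) = η k := by
  rw [← A.partialProd_right k, inv_perm_apply]

lemma goodConj_iff_linked (hf : Cyc f n) (A : Axis f n ξ η) {v : Gamma}
    (hv : act v = partialProd f n) {h : Gamma} {k l : ℤ}
    (e : act h = partialProd f k * (partialProd f l)⁻¹) :
    GoodConj v h ↔ Linked (ends ξ η k) (ends ξ η l) := by
  rw [A.goodConj_iff hf hv, e, Equiv.Perm.mul_apply, Equiv.Perm.mul_apply,
    A.inv_partialProd_left, A.inv_partialProd_right, A.ends_zero k, linked_partialProd_iff]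
  rfl

lemma exists_of_goodConj (hf : Cyc f n) (A : Axis f n ξ η) {v : Gamma}
    (hv : act v = partialProd f n) {h : Gamma} (hg : GoodConj v h) :
    ∃ k l, act h = partialProd f k * (partialProd f l)⁻¹ ∧ (k - l) % 2 = 0 := by
  refine (A.decomp_of_mem_Gamma h.2).resolve_right ?_
  rintro ⟨k, e, h1, h2, ⟨s, hs, es⟩, t, ht, et⟩
  rw [A.goodConj_iff hf hv, es, et, A.ends_zero k, linked_partialProd_iff] at hg
  refine not_linked_of_preconnected (isPreconnected_coe_image (arc_isPreconnected e)) ?_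
    (mem_image_of_mem _ hs) (mem_image_of_mem _ ht) hg
  rintro _ ⟨u, hu, rfl⟩ (h | h)
  · rw [OnePoint.coe_eq_coe] at h
    exact h1 (arc_disjoint hu (h ▸ A.mem_left k))
  · rw [mem_singleton_iff, OnePoint.coe_eq_coe] at h
    exact h2 (arc_disjoint hu (h ▸ A.mem_right k))

lemma ends_eq_of_dvd (hf : Cyc f n) (A : Axis f n ξ η) {k l : ℤ} (h : (n : ℤ) ∣ l - k) :
    ends ξ η l = ends ξ η k := by
  have : seg f l n = seg f k n := by
    refine List.map_congr_left fun j _ => hf.per_of_dvd ?_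
    rwa [add_sub_add_right_eq_sub]
  ext p
  have h1 := A.fix k p
  have h2 := A.fix l p
  rw [this, h1] at h2
  exact h2.symm

lemma exists_apart (hf : Cyc f n) (A : Axis f n ξ η) {k l : ℤ}
    (hL : Linked (ends ξ η k) (ends ξ η l)) (hkl : (k - l) % 2 = 0) :
    ∃ k' l', (k' - l') % 2 = 0 ∧ Apart f k' l' ∧
      partialProd f k * (partialProd f l)⁻¹ = partialProd f k' * (partialProd f l')⁻¹ := by
  by_cases ha : f (k - 1) = f (l - 1)
  · have hex : ∃ j : ℕ, f (k - 1 - j) ≠ f (l - 1 - j) := by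
      by_contra! h
      have := hf.dvd_of_forall_sub h
      rw [sub_sub_sub_cancel_right] at this
      rw [A.ends_eq_of_dvd hf this] at hL
      exact not_linked_self _ _ hL
    have hne := Nat.find_spec hex
    have hlt := fun j => Nat.find_min hex (m := j)
    set d := Nat.find hex with hd
    have h0 : d ≠ 0 := fun h => by
      rw [h] at hne
      simp [ha] at hne
    have hshift : ∀ j ≤ d, partialProd f k * (partialProd f l)⁻¹ =
        partialProd f (k - j) * (partialProd f (l - j))⁻¹ := by
      intro j
      induction j with
      | zero => simp
      | succ j ih =>
        intro hj
        rw [ih (by omega), Nat.cast_succ, ← sub_sub, ← sub_sub, partialProd_pred, partialProd_pred]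
        have := not_not.1 (hlt j (by omega))
        rw [sub_right_comm, sub_right_comm l] at this
        rw [this, mul_inv_rev, refl_inv, mul_assoc, ← mul_assoc (refl _), refl_mul_self, one_mul]
    refine ⟨k - d, l - d, by omega, ⟨?_, ?_⟩, hshift d le_rfl⟩
    · rwa [sub_right_comm, sub_right_comm l]
    · have := not_not.1 (hlt (d - 1) (by omega))
      rw [Nat.cast_sub (by omega), Nat.cast_one, sub_sub_sub_cancel_right,
        sub_sub_sub_cancel_right] at this
      have h2 := hf.red (k - d - 1)
      rwa [sub_add_cancel, this] at h2
  by_cases hb : f (k - 1) = f l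
  · have hex := hf.exists_ne_of_even hkl
    have hne := Nat.find_spec hex
    have hlt := fun j => Nat.find_min hex (m := j)
    set d := Nat.find hex with hd
    have h0 : d ≠ 0 := fun h => by
      rw [h] at hne
      simp [hb] at hne
    have hshift : ∀ j ≤ d, partialProd f k * (partialProd f l)⁻¹ =
        partialProd f (k - j) * (partialProd f (l + j))⁻¹ := by
      intro j
      induction j with
      | zero => simp
      | succ j ih =>
        intro hj
        rw [ih (by omega), Nat.cast_succ, ← sub_sub, ← add_assoc, partialProd_pred,
          partialProd_succ]
        have := not_not.1 (hlt j (by omega))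
        rw [sub_right_comm] at this
        rw [this, mul_inv_rev, refl_inv, mul_assoc, ← mul_assoc (refl _), refl_mul_self, one_mul]
    refine ⟨k - d, l + d, by omega, ⟨?_, ?_⟩, hshift d le_rfl⟩
    · have := not_not.1 (hlt (d - 1) (by omega))
      rw [Nat.cast_sub (by omega), Nat.cast_one, sub_sub_sub_cancel_right, ← add_sub_assoc] at this
      have h2 := hf.red (k - d - 1)
      rwa [sub_add_cancel, this] at h2
    · rwa [sub_right_comm]
  exact ⟨k, l, hkl, ⟨ha, hb⟩, rfl⟩

end Axis

lemma partialProd_eq_mul_wordPerm (f : ℤ → Letter) {k l : ℤ} (h : l ≤ k) :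
    partialProd f k = partialProd f l * wordPerm (seg f l (k - l).toNat) := by
  rw [← partialProd_add, Int.toNat_of_nonneg (by omega)]
  congr 1
  ring

lemma getLast_seg {f : ℤ → Letter} {k l : ℤ} {a : Letter} (h : l ≤ k)
    (ha : a ∈ (seg f l (k - l).toNat).getLast?) : a = f (k - 1) := by
  obtain ⟨m, hm⟩ : ∃ m : ℕ, k = l + m := ⟨(k - l).toNat, by omega⟩
  subst hm
  rw [add_sub_cancel_left, Int.toNat_natCast] at ha
  rcases m with _ | m
  · simp [seg] at ha
  · rw [seg_succ] at ha
    simp only [List.getLast?_append, List.getLast?_singleton, Option.mem_def, Option.some_or,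
      Option.some.injEq] at ha
    rw [← ha]
    congr 1
    push_cast
    ring

lemma eq_of_seg_eq_nil {f : ℤ → Letter} {k l : ℤ} (h : l ≤ k)
    (e : seg f l (k - l).toNat = []) : l = k := by
  have := congrArg List.length e
  rw [seg_length, List.length_nil] at this
  omega

lemma Apart.unique {f : ℤ → Letter} (hf : ∀ k, f k ≠ f (k + 1)) {k l k' l' : ℤ}
    (h : Apart f k l) (h' : Apart f k' l')
    (e : partialProd f k * (partialProd f l)⁻¹ = partialProd f k' * (partialProd f l')⁻¹) :
    k = k' ∧ l = l' := by
  wlog hk : k' ≤ k generalizing k l k' l'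
  · obtain ⟨h1, h2⟩ := this h' h e.symm (by omega)
    exact ⟨h1.symm, h2.symm⟩
  rw [partialProd_eq_mul_wordPerm f hk, mul_assoc, mul_right_inj, mul_inv_eq_iff_eq_mul] at e
  rcases le_total l' l with hl | hl
  · rw [partialProd_eq_mul_wordPerm f hl, inv_mul_cancel_left] at e
    obtain ⟨h1, h2⟩ := eq_nil_of_wordPerm_eq (seg_isChain hf _ _) (seg_isChain hf _ _)
      (fun a ha b hb => by rw [getLast_seg hk ha, getLast_seg hl hb]; exact h.1) e
    exact ⟨(eq_of_seg_eq_nil hk h1).symm, (eq_of_seg_eq_nil hl h2).symm⟩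
  · rw [partialProd_eq_mul_wordPerm f hl, mul_inv_rev, inv_mul_cancel_right,
      ← wordPerm_reverse] at e
    obtain ⟨h1, h2⟩ := eq_nil_of_wordPerm_eq (seg_isChain hf _ _)
      (List.isChain_reverse.2 ((seg_isChain hf _ _).imp fun _ _ => Ne.symm))
      (fun a ha b hb => by
        rw [getLast_seg hk ha]
        rw [List.getLast?_reverse] at hb
        obtain ⟨m, hm⟩ : ∃ m : ℕ, l' = l + m := ⟨(l' - l).toNat, by omega⟩
        subst hm
        rw [add_sub_cancel_left, Int.toNat_natCast] at hb
        rcases m with _ | m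
        · simp [seg] at hb
        · rw [seg_succ'] at hb
          simp only [List.head?_cons, Option.mem_def, Option.some.injEq] at hb
          rw [← hb]
          exact h.2) e
    exact ⟨(eq_of_seg_eq_nil hk h1).symm, eq_of_seg_eq_nil hl (List.reverse_eq_nil_iff.1 h2)⟩

end

/-! ### Counting self-intersections by crossing pairs of rays -/

/-- The pairs of positions of equal parity in the period starting at `c` whose rays cross. -/
def crossSet (f : ℤ → Letter) (n : ℕ) (c : ℤ) : Set (ℤ × ℤ) :=
  {p | (c ≤ p.1 ∧ p.1 < c + n) ∧ (c ≤ p.2 ∧ p.2 < c + n) ∧ (p.1 - p.2) % 2 = 0 ∧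
    CrossAt f p.1 p.2}

section

variable {f : ℤ → Letter} {n : ℕ} {ξ η : ℤ → ℝ}

lemma Cyc.fwd_add_mul (hf : Cyc f n) (k a : ℤ) : fwd f (k + a * n) = fwd f k := by
  funext j
  simp only [fwd]
  rw [show k + a * n - 1 + (j : ℤ) = k - 1 + j + a * n by ring, hf.per_mul]

lemma Cyc.bwd_add_mul (hf : Cyc f n) (k a : ℤ) : bwd f (k + a * n) = bwd f k := by
  funext j
  simp only [bwd]
  rw [show k + a * n - (j : ℤ) = k - j + a * n by ring, hf.per_mul]

lemma Cyc.crossAt_add_mul (hf : Cyc f n) (k l a b : ℤ) :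
    CrossAt f (k + a * n) (l + b * n) ↔ CrossAt f k l := by
  simp only [CrossAt, hf.fwd_add_mul, hf.bwd_add_mul]

lemma Cyc.exists_window (hf : Cyc f n) (c k : ℤ) :
    ∃ k₀ a : ℤ, c ≤ k₀ ∧ k₀ < c + n ∧ k = k₀ + a * n := by
  have hn : (0 : ℤ) < n := by exact_mod_cast hf.pos
  refine ⟨c + (k - c) % n, (k - c) / n, ?_, ?_, ?_⟩
  · have := Int.emod_nonneg (k - c) hn.ne'
    omega
  · have := Int.emod_lt_of_pos (k - c) hn
    omega
  · have := Int.emod_add_mul_ediv (k - c) n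
    linarith

lemma eq_of_window {c k k' a : ℤ} (h : c ≤ k ∧ k < c + n) (h' : c ≤ k' ∧ k' < c + n)
    (e : k = k' + a * n) : k = k' := by
  have ha : a = 0 := by
    rcases lt_trichotomy a 0 with ha | ha | ha
    · nlinarith
    · exact ha
    · nlinarith
  simpa [ha] using e

lemma Cyc.even_mul (hf : Cyc f n) (a : ℤ) : (a * n) % 2 = 0 := by
  obtain ⟨r, hr⟩ := hf.even
  rw [hr, Nat.cast_add, ← two_mul, mul_left_comm]
  exact Int.mul_emod_right 2 _

/-- Equality of double cosets in the quotient is the defining relation itself. -/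
lemma quot_mk_eq_iff {v : Gamma} (h h' : {h : Gamma // GoodConj v h}) :
    Quot.mk (fun h h' : {h : Gamma // GoodConj v h} =>
      ∃ m k : ℤ, (h' : Gamma) = v ^ m * (h : Gamma) * v ^ k) h = Quot.mk _ h' ↔
      ∃ m k : ℤ, (h' : Gamma) = v ^ m * (h : Gamma) * v ^ k := by
  have heq : Equivalence (fun h h' : {h : Gamma // GoodConj v h} =>
      ∃ m k : ℤ, (h' : Gamma) = v ^ m * (h : Gamma) * v ^ k) :=
    { refl := fun h => ⟨0, 0, by simp⟩
      symm := by
        rintro h h' ⟨m, k, e⟩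
        exact ⟨-m, -k, by rw [e]; group⟩
      trans := by
        rintro h h' h'' ⟨m, k, e⟩ ⟨m', k', e'⟩
        exact ⟨m' + m, k + k', by rw [e', e]; group⟩ }
  exact heq.quot_mk_eq_iff _ _

lemma Axis.sTwo_eq (hf : Cyc f n) (A : Axis f n ξ η) {v : Gamma}
    (hv : act v = partialProd f n) (c : ℤ) : sTwo v = (crossSet f n c).ncard := by
  have hex : ∀ p : crossSet f n c, ∃ h : Gamma,
      act h = partialProd f p.1.1 * (partialProd f p.1.2)⁻¹ :=
    fun p => exists_mem_Gamma_partialProd f p.2.2.2.1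
  choose h₀ hh₀ using hex
  have hgood : ∀ p, GoodConj v (h₀ p) := fun p =>
    (A.goodConj_iff_linked hf hv (hh₀ p)).2
      ((A.linked_iff hf p.2.2.2.1 (p.2.2.2.2.apart hf.red)).2 p.2.2.2.2)
  have hact : ∀ (m q : ℤ) (k l : ℤ) (h : Gamma),
      act h = partialProd f k * (partialProd f l)⁻¹ →
      act ((v ^ m * h * v ^ q : Gamma) : SL2Z) =
        partialProd f (k + m * n) * (partialProd f (l + -q * n))⁻¹ := by
    intro m q k l h e
    push_cast
    rw [map_mul, map_mul, map_zpow, map_zpow, hv, e, hf.partialProd_add_mul_period,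
      hf.partialProd_add_mul_period, mul_inv_rev, zpow_neg, inv_inv]
    simp only [mul_assoc]
  rw [sTwo, ← Nat.card_coe_set_eq]
  symm
  refine Nat.card_eq_of_bijective (fun p => Quot.mk _ ⟨h₀ p, hgood p⟩) ⟨?_, ?_⟩
  · intro p p' e
    obtain ⟨m, q, e⟩ := (quot_mk_eq_iff _ _).1 e
    have e1 := hact m q _ _ _ (hh₀ p)
    rw [← e, hh₀ p'] at e1
    have c1 := p.2.2.2.2
    have c2 := p'.2.2.2.2
    rw [← hf.crossAt_add_mul _ _ m (-q)] at c1
    obtain ⟨a1, a2⟩ := (c2.apart hf.red).unique hf.red (c1.apart hf.red) e1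
    exact (Subtype.ext (Prod.ext (eq_of_window p'.2.1 p.2.1 a1)
      (eq_of_window p'.2.2.1 p.2.2.1 a2))).symm
  · rintro ⟨h, hg⟩
    obtain ⟨k, l, e, hkl⟩ := A.exists_of_goodConj hf hv hg
    have hL := (A.goodConj_iff_linked hf hv e).1 hg
    obtain ⟨k', l', hkl', ha, e'⟩ := A.exists_apart hf hL hkl
    rw [e'] at e
    have hX := (A.linked_iff hf hkl' ha).1 ((A.goodConj_iff_linked hf hv e).1 hg)
    obtain ⟨k₀, a, hk1, hk2, rfl⟩ := hf.exists_window c k'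
    obtain ⟨l₀, b, hl1, hl2, rfl⟩ := hf.exists_window c l'
    rw [hf.crossAt_add_mul] at hX
    have := hf.even_mul a
    have := hf.even_mul b
    let p : crossSet f n c := ⟨(k₀, l₀), ⟨hk1, hk2⟩, ⟨hl1, hl2⟩, by
      change (k₀ - l₀) % 2 = 0
      omega, hX⟩
    refine ⟨p, (quot_mk_eq_iff _ _).2 ⟨a, -b, Subtype.ext
      (act_injOn_Gamma h.2 (Subtype.prop _) ?_)⟩⟩
    rw [hact a (-b) _ _ _ (hh₀ p), e, neg_neg]

/-! ### The period is not a proper power -/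

lemma Axis.left_eq_imp_dvd (hf : Cyc f n) (A : Axis f n ξ η) {k l : ℤ} (h : ξ k = ξ l) :
    (n : ℤ) ∣ l - k := by
  have key : ∀ j : ℕ, ξ (k + j) = ξ (l + j) := by
    intro j
    induction j with
    | zero => simpa using h
    | succ j ih =>
      have e : f (k + j) = f (l + j) := arc_disjoint (A.mem_left _) (ih ▸ A.mem_left _)
      have h1 := A.step_left (k + j)
      have h2 := A.step_left (l + j)
      rw [ih, ← h2, e] at h1
      have := (refl _).injective h1
      rw [OnePoint.coe_eq_coe, add_assoc, add_assoc] at this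
      exact_mod_cast this
  exact hf.dvd_of_forall_add fun j => arc_disjoint (A.mem_left _) (key j ▸ A.mem_left _)

lemma Axis.left_ne_right (hf : Cyc f n) (A : Axis f n ξ η) {k l : ℤ} (hkl : (k - l) % 2 = 0) :
    ξ l ≠ η k := by
  intro h
  have key : ∀ j : ℕ, ξ (l + j) = η (k - j) := by
    intro j
    induction j with
    | zero => simpa using h
    | succ j ih =>
      have e : f (l + j) = f (k - j - 1) := arc_disjoint (A.mem_left _) (ih ▸ A.mem_right _)
      have h1 := A.step_left (l + j)
      have h2 := A.step_right (k - j - 1)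
      rw [sub_add_cancel, ← ih, ← e, ← h1, refl_refl, OnePoint.coe_eq_coe, add_assoc,
        sub_sub] at h2
      exact_mod_cast h2
  obtain ⟨j, hj⟩ := hf.exists_ne_of_even hkl
  refine hj (arc_disjoint (t := ξ (l + j)) (key j ▸ ?_) (A.mem_left _))
  have := A.mem_right (k - j)
  rwa [sub_right_comm] at this

lemma Axis.notProperPower (hf : Cyc f n) (A : Axis f n ξ η) {v : Gamma}
    (hv : act v = partialProd f n) : NotProperPower v := by
  rintro ⟨u, m, hm, e⟩
  have hfix : ∀ p : OnePoint ℝ, p = ξ 0 ∨ p = η 0 → act u p = ξ 0 ∨ act u p = η 0 := by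
    intro p hp
    rw [← A.act_fix hv] at hp ⊢
    rw [← Equiv.Perm.mul_apply, ← map_mul,
      show ((v : SL2Z) * (u : SL2Z)) = u * v by rw [e]; push_cast; rw [← pow_succ, ← pow_succ'],
      map_mul, Equiv.Perm.mul_apply, hp]
  have h1 := hfix _ (Or.inl rfl)
  have hP : ∀ (k : ℤ) (s : ℝ), (partialProd f k s = (ξ 0 : OnePoint ℝ) → s = ξ k) ∧
      (partialProd f k s = (η 0 : OnePoint ℝ) → s = η k) := by
    intro k s
    constructor <;> intro h
    · rw [← A.partialProd_left k] at h
      simpa using (partialProd f k).injective h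
    · rw [← A.partialProd_right k] at h
      simpa using (partialProd f k).injective h
  rcases A.decomp_of_mem_Gamma u.2 with ⟨k, l, eu, hkl⟩ | ⟨k, c, hc1, hc2, ⟨s, hs, es⟩, -⟩
  · rw [eu, Equiv.Perm.mul_apply, A.inv_partialProd_left] at h1
    rcases h1 with h1 | h1
    · obtain ⟨a, ha⟩ := A.left_eq_imp_dvd hf ((hP k _).1 h1)
      obtain rfl : k = l + a * n := by linarith
      rw [hf.partialProd_add_mul_period, mul_inv_cancel_right] at eu
      have e2 : act v = act u ^ m := by rw [e]; push_cast; rw [map_pow]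
      rw [eu, hv, ← zpow_natCast, ← zpow_mul] at e2
      have e3 := hf.partialProd_add_mul_period 0 (a * m - 1)
      rw [zpow_sub_one, ← e2, mul_inv_cancel, partialProd_zero, one_mul, zero_add] at e3
      refine hf.partialProd_ne_one (k := (a * m - 1) * n) ?_ e3
      have hn : (n : ℤ) ≠ 0 := by exact_mod_cast hf.pos.ne'
      refine mul_ne_zero (fun h => ?_) hn
      have : (m : ℤ) ∣ 1 := ⟨a, by linarith⟩
      have := Int.le_of_dvd one_pos this
      omega
    · exact A.left_ne_right hf hkl ((hP k _).2 h1)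
  · rw [es] at h1
    rcases h1 with h1 | h1
    · exact hc1 (arc_disjoint hs ((hP k s).1 h1 ▸ A.mem_left k))
    · exact hc2 (arc_disjoint hs ((hP k s).2 h1 ▸ A.mem_right k))

end

lemma Iγ_of_notProperPower {v : Gamma} (hv : NotProperPower v) :
    Iγ v = ((sTwo v / 2 : ℕ) : ℤ) := by
  have h : ∃ p : Gamma × ℕ, 1 ≤ p.2 ∧ NotProperPower p.1 ∧ v = p.1 ^ p.2 :=
    ⟨(v, 1), le_rfl, hv, (pow_one v).symm⟩
  obtain ⟨h1, h2, h3⟩ := h.choose_spec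
  have h4 : h.choose.2 = 1 := by
    by_contra hne
    exact hv ⟨_, _, by omega, h3⟩
  rw [h4, pow_one] at h3
  rw [Iγ, dif_pos h, h4, ← h3]
  simp

lemma Iγ_eq {f : ℤ → Letter} {n : ℕ} (hf : Cyc f n) {v : Gamma}
    (hv : act v = partialProd f n) (c : ℤ) :
    Iγ v = (((crossSet f n c).ncard / 2 : ℕ) : ℤ) := by
  obtain ⟨ξ, η, A⟩ := hf.exists_axis
  rw [Iγ_of_notProperPower (A.notProperPower hf hv), A.sTwo_eq hf hv c]

/-! ### Expansion of a periodic word at its unique longest run -/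

/-- The `n`-periodic word `g` has a run of length `len` omitting the letter `c` at position `0`,
whose translates are the only windows of that length omitting `c`; the `(n + 2)`-periodic word `g'`
is obtained from `g` by repeating the first two letters of this run. -/
structure Expansion (g g' : ℤ → Letter) (n len : ℕ) (c : Letter) : Prop where
  even : Even n
  two_le : 2 ≤ len
  lt : len < n
  per : ∀ k, g (k + n) = g k
  per' : ∀ k, g' (k + (n + 2)) = g' k
  red : ∀ k, g k ≠ g (k + 1)
  head : ∀ j : ℤ, 0 ≤ j → j < 2 → g' j = g j
  tail : ∀ j : ℤ, 0 ≤ j → j < n → g' (j + 2) = g j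
  run : ∀ j : ℤ, 0 ≤ j → j < len → g j ≠ c
  pre : g (-1) = c
  post : g len = c
  uniq : ∀ q : ℤ, (∀ j : ℤ, 0 ≤ j → j < len → g (q + j) ≠ c) → (n : ℤ) ∣ q

lemma eq_of_ne_of_ne {a b c d : Letter} (h1 : a ≠ b) (h2 : b ≠ d) (ha : a ≠ c) (hb : b ≠ c)
    (hd : d ≠ c) : d = a := by
  cases a <;> cases b <;> cases c <;> cases d <;> simp_all

lemma per_mul_of_per {g : ℤ → Letter} {N : ℤ} (h : ∀ k, g (k + N) = g k) (k a : ℤ) :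
    g (k + a * N) = g k := by
  induction a with
  | zero => simp
  | succ a ih => rw [← ih, ← h (k + a * N)]; congr 1; ring
  | pred a ih => rw [← ih, ← h (k + (-a - 1) * N)]; congr 1; ring

lemma exists_residue {N : ℤ} (hN : 0 < N) (k : ℤ) :
    ∃ k₀ a : ℤ, 0 ≤ k₀ ∧ k₀ < N ∧ k = k₀ + a * N :=
  ⟨k % N, k / N, Int.emod_nonneg k hN.ne', Int.emod_lt_of_pos k hN, by
    have := Int.emod_add_mul_ediv k N
    linarith⟩

namespace Expansion

variable {g g' : ℤ → Letter} {n len : ℕ} {c : Letter}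

lemma alt (h : Expansion g g' n len c) {j : ℤ} (h0 : 0 ≤ j) (h1 : j + 2 < len) :
    g (j + 2) = g j := by
  have e : j + 2 = j + 1 + 1 := by ring
  have := h.red (j + 1)
  rw [← e] at this
  exact eq_of_ne_of_ne (h.red j) this (h.run _ h0 (by omega)) (h.run _ (by omega) (by omega))
    (h.run _ (by omega) h1)

lemma eq_left (h : Expansion g g' n len c) {j : ℤ} (h0 : -n ≤ j) (h1 : j < len) : g' j = g j := by
  have := h.lt
  rcases lt_or_ge j 0 with hj | hj
  · rw [← h.per' j, show j + ((n : ℤ) + 2) = j + n + 2 by ring, h.tail _ (by omega) (by omega),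
      h.per]
  rcases lt_or_ge j 2 with hj2 | hj2
  · exact h.head j hj hj2
  · have e := h.tail (j - 2) (by omega) (by omega)
    have e' := h.alt (j := j - 2) (by omega) (by omega)
    rw [sub_add_cancel] at e e'
    rw [e, e']

lemma eq_right (h : Expansion g g' n len c) {j : ℤ} (h0 : 0 ≤ j) (h1 : j < n + len) :
    g' (j + 2) = g j := by
  rcases lt_or_ge j n with hj | hj
  · exact h.tail j h0 hj
  · have e := h.per' (j - n)
    have e' := h.per (j - n)
    rw [show j - n + ((n : ℤ) + 2) = j + 2 by ring,
      h.eq_left (j := j - n) (by omega) (by omega)] at e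
    rw [sub_add_cancel] at e'
    rw [e, e']

lemma red' (h : Expansion g g' n len c) (k : ℤ) : g' k ≠ g' (k + 1) := by
  have hlen := h.two_le
  have hlt := h.lt
  obtain ⟨k, a, h0, h1, rfl⟩ := exists_residue (N := n + 2) (by omega) k
  rw [add_right_comm, per_mul_of_per h.per', per_mul_of_per h.per']
  rcases lt_or_ge k 2 with hk | hk
  · rw [h.eq_left (by omega) (by omega)]
    rcases lt_or_ge (k + 1) len with hk1 | hk1
    · rw [h.eq_left (by omega) hk1]
      exact h.red k
    · obtain rfl : k = 1 := by omega
      rw [show (1 : ℤ) + 1 = 0 + 2 by ring, h.eq_right le_rfl (by omega)]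
      exact (h.red 0).symm
  · have e1 := h.eq_right (j := k - 2) (by omega) (by omega)
    have e2 := h.eq_right (j := k - 1) (by omega) (by omega)
    rw [sub_add_cancel] at e1
    rw [show k - 1 + 2 = k + 1 by ring] at e2
    rw [e1, e2]
    have := h.red (k - 2)
    rwa [show k - 2 + 1 = k - 1 by ring] at this

lemma run' (h : Expansion g g' n len c) {j : ℤ} (h0 : 0 ≤ j) (h1 : j < len + 2) : g' j ≠ c := by
  have hlen := h.two_le
  rcases lt_or_ge j len with hj | hj
  · rw [h.eq_left (by omega) hj]
    exact h.run j h0 hj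
  · have := h.eq_right (j := j - 2) (by omega) (by omega)
    rw [sub_add_cancel] at this
    rw [this]
    exact h.run _ (by omega) (by omega)

lemma alt' (h : Expansion g g' n len c) {j : ℤ} (h0 : 0 ≤ j) (h1 : j < len) :
    g' (j + 2) = g' j := by
  have e : j + 2 = j + 1 + 1 := by ring
  have := h.red' (j + 1)
  rw [← e] at this
  exact eq_of_ne_of_ne (h.red' j) this (h.run' h0 (by omega)) (h.run' (by omega) (by omega))
    (h.run' (by omega) (by omega))

lemma run_parity (h : Expansion g g' n len c) {i j : ℤ} (hi0 : 0 ≤ i) (hi1 : i < len + 2)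
    (hj0 : 0 ≤ j) (hj1 : j < len + 2) : g' i = g' j ↔ (i - j) % 2 = 0 := by
  have key : ∀ m : ℕ, (2 * m : ℤ) < len + 2 → g' (2 * m : ℤ) = g' 0 := by
    intro m
    induction m with
    | zero => simp
    | succ m ih =>
      intro hm
      push_cast at hm ⊢
      rw [mul_add, mul_one, h.alt' (by omega) (by omega), ih (by omega)]
  have key' : ∀ m : ℕ, (2 * m + 1 : ℤ) < len + 2 → g' (2 * m + 1 : ℤ) = g' 1 := by
    intro m
    induction m with
    | zero => simp
    | succ m ih =>
      intro hm
      push_cast at hm ⊢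
      rw [mul_add, mul_one, add_right_comm, h.alt' (by omega) (by omega), ih (by omega)]
  have h01 := h.red' 0
  rw [zero_add] at h01
  have val : ∀ i : ℤ, 0 ≤ i → i < len + 2 → g' i = if i % 2 = 0 then g' 0 else g' 1 := by
    intro i h0 h1
    split_ifs with hi
    · have := key (i / 2).toNat (by omega)
      rwa [show 2 * ((i / 2).toNat : ℤ) = i by omega] at this
    · have := key' (i / 2).toNat (by omega)
      rwa [show 2 * ((i / 2).toNat : ℤ) + 1 = i by omega] at this
  rw [val i hi0 hi1, val j hj0 hj1]
  split_ifs with h1 h2 h2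
  · simp; omega
  · simp [h01]; omega
  · simp [h01.symm]; omega
  · simp; omega

lemma uniq' (h : Expansion g g' n len c) {q : ℤ}
    (hq : ∀ j : ℤ, 0 ≤ j → j < len → g' (q + j) ≠ c) :
    ∃ e a : ℤ, 0 ≤ e ∧ e ≤ 2 ∧ q = e + a * (n + 2) := by
  obtain ⟨k, a, h0, h1, rfl⟩ := exists_residue (N := n + 2) (by omega) q
  refine ⟨k, a, h0, ?_, rfl⟩
  by_contra! hk
  have hdvd := h.uniq (k - 2) fun j hj0 hj1 => by
    rw [← h.eq_right (by omega) (by omega)]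
    have := hq j hj0 hj1
    rwa [add_right_comm, per_mul_of_per h.per', show k + j = k - 2 + j + 2 by ring] at this
  have := Int.le_of_dvd (by omega) hdvd
  omega

lemma cyc (h : Expansion g g' n len c) : Cyc g n where
  pos := by have := h.lt; omega
  even := h.even
  per := h.per
  red := h.red
  aper := fun d hd => h.uniq d fun j h0 h1 => by
    rw [add_comm, hd]
    exact h.run j h0 h1
  occ := fun a => by
    have hlen := h.two_le
    have h01 := h.red 0
    rw [zero_add] at h01
    by_cases ha : a = c
    · exact ⟨-1, h.pre.trans ha.symm⟩
    · rcases letter_cases (h.run 0 le_rfl (by omega)).symm (h.run 1 (by omega) (by omega)).symm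
        h01 ha with e | e
      exacts [⟨0, e.symm⟩, ⟨1, e.symm⟩]

lemma cyc' (h : Expansion g g' n len c) : Cyc g' (n + 2) where
  pos := by omega
  even := by have := h.even; rwa [Nat.even_add_one, Nat.even_add_one, not_not]
  per := fun k => by push_cast; exact h.per' k
  red := h.red'
  aper := fun d hd => by
    have hlen := h.two_le
    have hlt := h.lt
    obtain ⟨e, a, he0, he2, ed⟩ := h.uniq' (q := d) fun j h0 h1 => by
      rw [add_comm, hd]
      exact h.run' h0 (by omega)
    obtain ⟨e', a', he0', he2', ed'⟩ := h.uniq' (q := d + 2) fun j h0 h1 => by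
      rw [add_assoc, add_comm, hd]
      exact h.run' (by omega) (by omega)
    have h1 : (e + 2 - e') = (a' - a) * ((n : ℤ) + 2) := by linarith
    have h2 : a' - a = 0 := by
      obtain ⟨r, hr⟩ := h.even
      rcases lt_trichotomy (a' - a) 0 with h3 | h3 | h3
      · nlinarith
      · exact h3
      · nlinarith
    rw [h2, zero_mul] at h1
    refine ⟨a, ?_⟩
    push_cast
    rw [ed, show e = 0 by omega]
    ring
  occ := fun a => by
    have hlen := h.two_le
    have h01 := h.red' 0
    rw [zero_add] at h01
    by_cases ha : a = c
    · exact ⟨-1, by rw [h.eq_left (by have := h.lt; omega) (by omega), h.pre, ha]⟩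
    · rcases letter_cases (h.run' le_rfl (by omega)).symm
        (h.run' (j := 1) (by omega) (by omega)).symm h01 ha with e | e
      exacts [⟨0, e.symm⟩, ⟨1, e.symm⟩]

end Expansion

lemma cross_congr {ρ σ ρ' σ' : ℕ → Letter} {m : ℕ} (hρ : ∀ j ≤ m, ρ j = ρ' j)
    (hσ : ∀ j ≤ m, σ j = σ' j) (hne : ∃ j, 1 ≤ j ∧ j ≤ m ∧ ρ j ≠ σ j) :
    Cross ρ σ ↔ Cross ρ' σ' := by
  have key : ∀ {ρ σ ρ' σ' : ℕ → Letter}, (∀ j ≤ m, ρ j = ρ' j) → (∀ j ≤ m, σ j = σ' j) →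
      (∃ j, 1 ≤ j ∧ j ≤ m ∧ ρ j ≠ σ j) → Cross ρ σ → Cross ρ' σ' := by
    rintro ρ σ ρ' σ' hρ hσ ⟨j, hj1, hjm, hj⟩ ⟨h0, d, hd, he, hdne, h⟩
    have hdm : d ≤ m := by
      by_contra! hlt
      exact hj (he j hj1 (by omega))
    refine ⟨?_, d, hd, fun i h1 h2 => ?_, ?_, ?_⟩
    · rwa [← hρ 0 (by omega), ← hσ 0 (by omega)]
    · rw [← hρ i (by omega), ← hσ i (by omega), he i h1 h2]
    · rwa [← hρ d hdm, ← hσ d hdm]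
    · rwa [← hρ 0 (by omega), ← hρ 1 (by omega), ← hρ d hdm, ← hρ (d - 1) (by omega)]
  refine ⟨key hρ hσ hne, key (fun j hj => (hρ j hj).symm) (fun j hj => (hσ j hj).symm) ?_⟩
  obtain ⟨j, h1, h2, h3⟩ := hne
  exact ⟨j, h1, h2, by rwa [← hρ j h2, ← hσ j h2]⟩

lemma eq_nextL_iff_not {a b c : Letter} (h1 : a ≠ b) (h2 : a ≠ c) (h3 : b ≠ c) :
    a = nextL b ↔ ¬ a = nextL c := by
  cases a <;> cases b <;> cases c <;> simp_all [nextL]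

lemma eq_nextL_comm {a b : Letter} (h : a ≠ b) : a = nextL b ↔ ¬ b = nextL a := by
  cases a <;> cases b <;> simp_all [nextL]

lemma eq_nextL_iff_not' {a b c : Letter} (h1 : a ≠ c) (h2 : b ≠ c) (h3 : a ≠ b) :
    a = nextL c ↔ ¬ b = nextL c := by
  cases a <;> cases b <;> cases c <;> simp_all [nextL]

lemma Cross.symm {ρ σ : ℕ → Letter} (hρ : ∀ j, ρ j ≠ ρ (j + 1)) (hσ : ∀ j, σ j ≠ σ (j + 1))
    (h : Cross ρ σ) : Cross σ ρ := by
  have h1 := h.one_eq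
  obtain ⟨h0, d, hd, he, hne, h⟩ := h
  refine ⟨h0.symm, d, hd, fun i a b => (he i a b).symm, hne.symm, ?_⟩
  have e := he (d - 1) (by omega) (by omega)
  have r1 := hρ 0
  have r2 := hσ 0
  have r3 := hρ (d - 1)
  have r4 := hσ (d - 1)
  rw [Nat.sub_add_cancel (by omega)] at r3 r4
  rw [zero_add] at r1 r2
  rw [← h, ← h1, ← e, eq_nextL_iff_not (b := σ 0) (c := ρ 0) (h1 ▸ r2.symm) r1.symm h0.symm,
    eq_nextL_iff_not' (a := σ d) (b := ρ d) (e ▸ r4.symm) r3.symm hne.symm]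
  tauto

/-- A ray crossing an alternating ray follows it as long as it alternates. -/
lemma Cross.eq_of_alternating {ρ σ : ℕ → Letter} {m : ℕ} (hρ : ∀ j, ρ j ≠ ρ (j + 1))
    (halt : ∀ j, j + 2 ≤ m → ρ (j + 2) = ρ j) (h : Cross ρ σ) {j : ℕ} (h1 : 1 ≤ j)
    (hm : j ≤ m) : ρ j = σ j := by
  obtain ⟨_, d, hd, he, _, h⟩ := h
  refine he j h1 (lt_of_not_ge fun hdj => ?_)
  have e0 : ∀ i, 2 * i ≤ m → ρ (2 * i) = ρ 0 := by
    intro i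
    induction i with
    | zero => simp
    | succ i ih => intro hi; rw [mul_add, mul_one, halt _ (by omega), ih (by omega)]
  have e1 : ∀ i, 2 * i + 1 ≤ m → ρ (2 * i + 1) = ρ 1 := by
    intro i
    induction i with
    | zero => simp
    | succ i ih =>
      intro hi; rw [mul_add, mul_one, add_right_comm, halt _ (by omega), ih (by omega)]
  have r := hρ 0
  rw [zero_add] at r
  rcases Nat.even_or_odd' d with ⟨i, rfl | rfl⟩
  · rw [e0 i (by omega), show 2 * i - 1 = 2 * (i - 1) + 1 by omega, e1 _ (by omega),
      eq_nextL_comm r] at h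
    simp at h
  · rw [e1 i (by omega), Nat.add_sub_cancel, e0 i (by omega)] at h
    simp at h

lemma fwd_apply (f : ℤ → Letter) (k : ℤ) (j : ℕ) : fwd f k j = f (k - 1 + j) := rfl

lemma bwd_apply (f : ℤ → Letter) (l : ℤ) (j : ℕ) : bwd f l j = f (l - j) := rfl

namespace Expansion

variable {g g' : ℤ → Letter} {n len : ℕ} {c : Letter}

/-- The position in the expanded word corresponding to the start of a backward ray. -/
def shiftB (len : ℕ) (l : ℤ) : ℤ := if l < len then l else l + 2

lemma fwd_eq (h : Expansion g g' n len c) {k : ℤ} (hk : 1 ≤ k) {j : ℕ}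
    (hj : k + j ≤ n + len) : fwd g k j = fwd g' (k + 2) j := by
  have := h.eq_right (j := k - 1 + j) (by omega) (by omega)
  rw [fwd_apply, fwd_apply, ← this]
  congr 1
  ring

/-- The length of the initial part of the backward ray ending with its first full traversal of
the run. -/
def depthB (n len : ℕ) (l : ℤ) : ℕ := (if l < len then l + n else l).toNat

lemma bwd_eq (h : Expansion g g' n len c) {l : ℤ} (hl : 1 ≤ l) (hln : l ≤ n) {j : ℕ}
    (hj : j ≤ depthB n len l) : bwd g l j = bwd g' (shiftB len l) j := by
  rw [bwd_apply, bwd_apply]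
  unfold depthB at hj
  unfold shiftB
  have := h.two_le
  split_ifs at hj ⊢ with hc
  · exact (h.eq_left (by omega) (by omega)).symm
  · rw [← h.eq_right (by omega) (by omega)]
    congr 1
    ring

lemma not_dvd_sub {k l : ℤ} (hk : 1 ≤ k) (hkn : k ≤ n) (hl : 1 ≤ l) (hln : l ≤ n) (hne : k ≠ l) :
    ¬ (n : ℤ) ∣ l - k := by
  rintro ⟨a, ha⟩
  refine hne (eq_of_window (n := n) (c := 1) (a := -a) ⟨hk, by omega⟩ ⟨hl, by omega⟩ ?_)
  linarith

lemma exists_fwd_ne_fwd (h : Expansion g g' n len c) {k l : ℤ} (hk : 1 ≤ k) (hkn : k ≤ n)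
    (hl : 1 ≤ l) (hln : l ≤ n) (hne : k ≠ l) :
    ∃ j : ℕ, 1 ≤ j ∧ k + j ≤ n + len ∧ fwd g k j ≠ fwd g l j := by
  by_contra! hall
  refine not_dvd_sub hk hkn hl hln hne (h.uniq (l - k) fun j h0 h1 => ?_)
  have e := hall (n + 1 - k + j).toNat (by omega) (by omega)
  rw [fwd_apply, fwd_apply, Int.toNat_of_nonneg (by omega),
    show k - 1 + (n + 1 - k + j) = j + n by ring, h.per,
    show l - 1 + (n + 1 - k + j) = (l - k + j) + n by ring, h.per] at e
  rw [← e]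
  exact h.run j h0 h1

lemma cross_fwd_fwd (h : Expansion g g' n len c) {k l : ℤ} (hk : 1 ≤ k) (hkn : k ≤ n)
    (hl : 1 ≤ l) (hln : l ≤ n) :
    Cross (fwd g k) (fwd g l) ↔ Cross (fwd g' (k + 2)) (fwd g' (l + 2)) := by
  rcases eq_or_ne k l with rfl | hne
  · exact iff_of_false (fun h => h.1 rfl) fun h => h.1 rfl
  rcases le_total k l with hkl | hkl
  · refine cross_congr (m := (n + len - l).toNat) (fun j hj => h.fwd_eq hk (by omega))
      (fun j hj => h.fwd_eq hl (by omega)) ?_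
    obtain ⟨j, h1, h2, h3⟩ := h.exists_fwd_ne_fwd hl hln hk hkn hne.symm
    exact ⟨j, h1, by omega, h3.symm⟩
  · refine cross_congr (m := (n + len - k).toNat) (fun j hj => h.fwd_eq hk (by omega))
      (fun j hj => h.fwd_eq hl (by omega)) ?_
    obtain ⟨j, h1, h2, h3⟩ := h.exists_fwd_ne_fwd hk hkn hl hln hne
    exact ⟨j, h1, by omega, h3⟩

/-- The run is not a palindrome centred at a point between two positions of equal parity. -/
lemma not_reversed_run (h : Expansion g g' n len c) {k l a : ℤ} (hkl : (k - l) % 2 = 0)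
    (ha : k + l - len = a * n) : g 0 ≠ g (len - 1) := by
  have hlen := h.two_le
  have h2 := h.cyc.even_mul a
  rw [← h.eq_left (by omega) (by omega), ← h.eq_left (by omega) (by omega), Ne,
    h.run_parity (by omega) (by omega) (by omega) (by omega)]
  omega

lemma exists_fwd_ne_bwd (h : Expansion g g' n len c) {k l : ℤ} (hkl : (k - l) % 2 = 0)
    (hkn : k ≤ n) :
    ∃ j : ℕ, 1 ≤ j ∧ k + j ≤ n + len ∧ fwd g k j ≠ bwd g l j := by
  by_contra! hall
  have hlen := h.two_le
  have key : ∀ i : ℤ, 0 ≤ i → i < len → g i = g (l + k - 1 - i) := by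
    intro i h0 h1
    have e := hall (n + 1 - k + i).toNat (by omega) (by omega)
    rwa [fwd_apply, bwd_apply, Int.toNat_of_nonneg (by omega),
      show k - 1 + (n + 1 - k + i) = i + n by ring, h.per,
      show l - (n + 1 - k + i) = l + k - 1 - i - n by ring, ← h.per (l + k - 1 - i - n),
      sub_add_cancel] at e
  obtain ⟨a, ha⟩ := h.uniq (l + k - len) fun j h0 h1 => by
    have := key (len - 1 - j) (by omega) (by omega)
    rw [show l + k - 1 - (len - 1 - j) = l + k - len + j by ring] at this
    rw [← this]
    exact h.run _ (by omega) (by omega)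
  refine h.not_reversed_run hkl (a := a) (by linarith) ?_
  rw [key 0 le_rfl (by omega), show l + k - 1 - 0 = len - 1 + a * n by linarith,
    h.cyc.per_mul]

lemma exists_bwd_ne_fwd (h : Expansion g g' n len c) {k l : ℤ} (hkl : (k - l) % 2 = 0)
    (hl : 1 ≤ l) :
    ∃ j : ℕ, 1 ≤ j ∧ j ≤ depthB n len l ∧ fwd g k j ≠ bwd g l j := by
  by_contra! hall
  have hlen := h.two_le
  have key : ∀ i : ℤ, 0 ≤ i → i < len → g (k - 1 + l - i) = g i := by
    intro i h0 h1
    have hlt := h.lt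
    unfold depthB at hall
    split_ifs at hall with hc
    · have e := hall (l + n - i).toNat (by omega) (by omega)
      rwa [fwd_apply, bwd_apply, Int.toNat_of_nonneg (by omega),
        show k - 1 + (l + n - i) = k - 1 + l - i + n by ring, h.per,
        show l - (l + n - i) = i - n by ring, ← h.per (i - n), sub_add_cancel] at e
    · have e := hall (l - i).toNat (by omega) (by omega)
      rwa [fwd_apply, bwd_apply, Int.toNat_of_nonneg (by omega), ← add_sub_assoc,
        sub_sub_cancel] at e
  obtain ⟨a, ha⟩ := h.uniq (k + l - len) fun j h0 h1 => by
    have := key (len - 1 - j) (by omega) (by omega)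
    rw [show k - 1 + l - (len - 1 - j) = k + l - len + j by ring] at this
    rw [this]
    exact h.run _ (by omega) (by omega)
  refine h.not_reversed_run hkl (a := a) (by linarith) ?_
  rw [← key 0 le_rfl (by omega), show k - 1 + l - 0 = len - 1 + a * n by linarith,
    h.cyc.per_mul]

lemma cross_fwd_bwd (h : Expansion g g' n len c) {k l : ℤ} (hkl : (k - l) % 2 = 0) (hk : 1 ≤ k)
    (hkn : k ≤ n) (hl : 1 ≤ l) (hln : l ≤ n) :
    Cross (fwd g k) (bwd g l) ↔ Cross (fwd g' (k + 2)) (bwd g' (shiftB len l)) := by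
  rcases le_total (n + len - k).toNat (depthB n len l) with hm | hm
  · refine cross_congr (m := (n + len - k).toNat) (fun j hj => h.fwd_eq hk (by omega))
      (fun j hj => h.bwd_eq hl hln (by omega)) ?_
    obtain ⟨j, h1, h2, h3⟩ := h.exists_fwd_ne_bwd hkl hkn
    exact ⟨j, h1, by omega, h3⟩
  · refine cross_congr (m := depthB n len l) (fun j hj => h.fwd_eq hk (by omega))
      (fun j hj => h.bwd_eq hl hln hj) ?_
    exact h.exists_bwd_ne_fwd hkl hl

end Expansion

/-- Pairs of positions whose forward rays cross. -/
def fwdSet (f : ℤ → Letter) (n : ℕ) : Set (ℤ × ℤ) :=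
  {p | (1 ≤ p.1 ∧ p.1 ≤ n) ∧ (1 ≤ p.2 ∧ p.2 ≤ n) ∧ (p.1 - p.2) % 2 = 0 ∧
    Cross (fwd f p.1) (fwd f p.2)}

/-- Pairs of positions whose forward and backward rays cross. -/
def bwdSet (f : ℤ → Letter) (n : ℕ) : Set (ℤ × ℤ) :=
  {p | (1 ≤ p.1 ∧ p.1 ≤ n) ∧ (1 ≤ p.2 ∧ p.2 ≤ n) ∧ (p.1 - p.2) % 2 = 0 ∧
    Cross (fwd f p.1) (bwd f p.2)}

lemma finite_fwdSet (f : ℤ → Letter) (n : ℕ) : (fwdSet f n).Finite :=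
  ((finite_Icc (1 : ℤ) n).prod (finite_Icc (1 : ℤ) n)).subset fun _ hp => ⟨hp.1, hp.2.1⟩

lemma finite_bwdSet (f : ℤ → Letter) (n : ℕ) : (bwdSet f n).Finite :=
  ((finite_Icc (1 : ℤ) n).prod (finite_Icc (1 : ℤ) n)).subset fun _ hp => ⟨hp.1, hp.2.1⟩

lemma ncard_crossSet {f : ℤ → Letter} (hf : ∀ k, f k ≠ f (k + 1)) (n : ℕ) :
    (crossSet f n 1).ncard = (fwdSet f n).ncard + (bwdSet f n).ncard := by
  have hd : Disjoint (fwdSet f n) (bwdSet f n) := by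
    refine Set.disjoint_left.2 fun p h1 h2 => ?_
    have e1 := h1.2.2.2.one_eq
    have e2 := h2.2.2.2.one_eq
    rw [e1, fwd_apply, bwd_apply] at e2
    have := hf (p.2 - 1)
    rw [Nat.cast_one] at e2
    rw [sub_add_cancel] at this e2
    exact this e2.symm
  rw [← ncard_union_eq hd (finite_fwdSet f n) (finite_bwdSet f n)]
  congr 1
  ext p
  simp only [crossSet, fwdSet, bwdSet, CrossAt, mem_union, mem_ofPred_eq, add_comm (1 : ℤ),
    Int.lt_add_one_iff]
  tauto

namespace Expansion

variable {g g' : ℤ → Letter} {n len : ℕ} {c : Letter}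

lemma position_cases {l e a N : ℤ} (hN : 3 ≤ N) (h1 : 1 ≤ l) (h2 : l ≤ N) (he : 0 ≤ e)
    (he2 : e ≤ 2) (hl : l = e + a * N) : l = 1 ∨ l = 2 ∨ l = N := by
  rcases lt_trichotomy a 0 with ha | rfl | ha
  · nlinarith
  · omega
  · exact Or.inr (Or.inr (le_antisymm h2 (by nlinarith)))

lemma parity_of_eq (h : Expansion g g' n len c) {i j a b : ℤ} (hi0 : 0 ≤ i) (hi1 : i < len + 2)
    (hj0 : 0 ≤ j) (hj1 : j < len + 2) (e : g' (i + a * (n + 2)) = g' (j + b * (n + 2))) :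
    (i - j) % 2 = 0 := by
  rwa [per_mul_of_per h.per', per_mul_of_per h.per', h.run_parity hi0 hi1 hj0 hj1] at e

lemma even_mul' (h : Expansion g g' n len c) (a : ℤ) : (a * ((n : ℤ) + 2)) % 2 = 0 := by
  have := h.cyc'.even_mul a
  push_cast at this
  exact this

lemma fwd_alternating (h : Expansion g g' n len c) {s : ℤ} (h1 : 1 ≤ s) (h2 : s ≤ 2) (j : ℕ)
    (hj : j + 2 ≤ len) : fwd g' s (j + 2) = fwd g' s j := by
  rw [fwd_apply, fwd_apply, ← h.alt' (j := s - 1 + j) (by omega) (by omega)]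
  congr 1
  push_cast
  ring

lemma bwd_alternating (h : Expansion g g' n len c) {l : ℤ} (h1 : len ≤ l) (h2 : l ≤ len + 1)
    (j : ℕ) (hj : j + 2 ≤ len) : bwd g' l (j + 2) = bwd g' l j := by
  rw [bwd_apply, bwd_apply]
  have := h.alt' (j := l - (j + 2 : ℕ)) (by omega) (by omega)
  rw [← this]
  congr 1
  push_cast
  ring

lemma eq_of_cross_fwd_fwd (h : Expansion g g' n len c) {s l : ℤ} (hs1 : 1 ≤ s) (hs2 : s ≤ 2)
    (hl1 : 1 ≤ l) (hl2 : l ≤ n + 2) (hp : (s - l) % 2 = 0)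
    (hc : Cross (fwd g' s) (fwd g' l)) : s = 2 ∧ l = n + 2 := by
  have hlen := h.two_le
  have hlt := h.lt
  obtain ⟨e, a, he0, he2, hl⟩ := h.uniq' (q := l) fun j h0 h1 => by
    have := hc.eq_of_alternating (m := len) (fwd_ne h.red' s) (h.fwd_alternating hs1 hs2)
      (j := (j + 1).toNat) (by omega) (by omega)
    rw [fwd_apply, fwd_apply, Int.toNat_of_nonneg (by omega),
      show l - 1 + (j + 1) = l + j by ring] at this
    rw [← this]
    exact h.run' (by omega) (by omega)
  have hev := h.even_mul' 1
  rcases position_cases (by omega) hl1 hl2 he0 he2 hl with e | e | e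
  · obtain rfl : s = l := by omega
    exact absurd rfl hc.1
  · obtain rfl : s = l := by omega
    exact absurd rfl hc.1
  · omega

lemma not_cross_fwd_bwd_of_left (h : Expansion g g' n len c) {s l : ℤ} (hs1 : 1 ≤ s)
    (hs2 : s ≤ 2) (hp : (s - l) % 2 = 0) : ¬ Cross (fwd g' s) (bwd g' l) := by
  intro hc
  have hlen := h.two_le
  have key := fun {j : ℕ} => hc.eq_of_alternating (m := len) (j := j) (fwd_ne h.red' s)
    (h.fwd_alternating hs1 hs2)
  obtain ⟨e, a, he0, he2, hl⟩ := h.uniq' (q := l - len) fun j h0 h1 => by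
    have := key (j := (len - j).toNat) (by omega) (by omega)
    rw [fwd_apply, bwd_apply, Int.toNat_of_nonneg (by omega),
      show l - (len - j) = l - len + j by ring] at this
    rw [← this]
    exact h.run' (by omega) (by omega)
  have h1 := key (j := 1) le_rfl (by omega)
  rw [fwd_apply, bwd_apply, Nat.cast_one, sub_add_cancel,
    show l - 1 = (len - 1 + e) + a * (n + 2) by linarith, show s = s + 0 * (n + 2) by ring] at h1
  have := h.parity_of_eq (by omega) (by omega) (by omega) (by omega) h1
  have := h.even_mul' a
  omega

lemma not_cross_fwd_bwd_of_right (h : Expansion g g' n len c) {k l : ℤ} (hl1 : len ≤ l)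
    (hl2 : l ≤ len + 1) (hp : (k - l) % 2 = 0) : ¬ Cross (fwd g' k) (bwd g' l) := by
  intro hc
  have hlen := h.two_le
  have key := fun {j : ℕ} => (hc.symm (fwd_ne h.red' k) (bwd_ne h.red' l)).eq_of_alternating
    (m := len) (j := j) (bwd_ne h.red' l) (h.bwd_alternating hl1 hl2)
  obtain ⟨e, a, he0, he2, hl⟩ := h.uniq' (q := k) fun j h0 h1 => by
    have := key (j := (j + 1).toNat) (by omega) (by omega)
    rw [fwd_apply, bwd_apply, Int.toNat_of_nonneg (by omega),
      show k - 1 + (j + 1) = k + j by ring] at this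
    rw [← this]
    exact h.run' (by omega) (by omega)
  have h1 := key (j := 1) le_rfl (by omega)
  rw [fwd_apply, bwd_apply, Nat.cast_one, sub_add_cancel, hl,
    show l - 1 = l - 1 + 0 * (n + 2) by ring] at h1
  have := h.parity_of_eq (by omega) (by omega) (by omega) (by omega) h1
  have := h.even_mul' a
  omega

lemma cross_new (h : Expansion g g' n len c) : Cross (fwd g' 2) (fwd g' (n + 2)) := by
  have hlen := h.two_le
  have hlt := h.lt
  have hc : g' (-1) = c := by rw [h.eq_left (by omega) (by omega), h.pre]
  have hσ : ∀ j : ℕ, fwd g' (n + 2) j = g' (j - 1) := fun j => by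
    rw [fwd_apply, ← h.per' ((j : ℤ) - 1)]
    congr 1
    ring
  have hρ : ∀ j : ℕ, fwd g' 2 j = g' (j + 1) := fun j => by
    rw [fwd_apply]
    congr 1
    ring
  have hpost : g' (len + 2) = c := by rw [h.eq_right (by omega) (by omega), h.post]
  have r0 : g' 1 ≠ c := h.run' (by omega) (by omega)
  have r2 : g' 2 ≠ c := h.run' (by omega) (by omega)
  rw [cross_iff_of_ne (d := len + 1)]
  · rw [hρ, hρ, hρ, hρ, Nat.add_sub_cancel, Nat.cast_zero, zero_add, Nat.cast_one,
      Nat.cast_add, Nat.cast_one, add_assoc, one_add_one_eq_two, hpost]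
    have h12 := h.red' 1
    rw [one_add_one_eq_two] at h12
    rcases Nat.even_or_odd len with hev | hodd
    · have : g' (len + 1) = g' 1 := by
        obtain ⟨r, hr⟩ := hev
        rw [h.run_parity (by omega) (by omega) (by omega) (by omega)]
        omega
      rw [this, eq_nextL_iff_not' r0.symm h12.symm r2.symm]
      simp [Nat.even_add_one, hev]
    · have : g' (len + 1) = g' 2 := by
        obtain ⟨r, hr⟩ := hodd
        rw [h.run_parity (by omega) (by omega) (by omega) (by omega)]
        omega
      rw [this]
      simp only [Nat.even_add_one, Nat.not_even_iff_odd, hodd, iff_true]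
      generalize g' 2 = p at *
      generalize g' 1 = q at *
      cases p <;> cases q <;> cases c <;> simp_all [nextL]
  · rw [hρ, hσ, Nat.cast_zero, zero_add, zero_sub, hc]
    exact r0
  · omega
  · intro j h1 h2
    rw [hρ, hσ, ← h.alt' (j := j - 1) (by omega) (by omega)]
    congr 1
    ring
  · rw [hρ, hσ, Nat.cast_add, Nat.cast_one, add_assoc, one_add_one_eq_two, hpost,
      add_sub_cancel_right]
    exact (h.run' (by omega) (by omega)).symm

lemma ncard_fwdSet (h : Expansion g g' n len c) :
    (fwdSet g' (n + 2)).ncard = (fwdSet g n).ncard + 2 := by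
  have hlt := h.lt
  have hev := h.even_mul' 1
  have hU : fwdSet g' (n + 2) = (fun p : ℤ × ℤ => (p.1 + 2, p.2 + 2)) '' fwdSet g n ∪
      {((2 : ℤ), (n : ℤ) + 2), ((n : ℤ) + 2, (2 : ℤ))} := by
    ext ⟨k, l⟩
    simp only [fwdSet, mem_union, mem_image, mem_ofPred_eq, Prod.exists, Prod.mk.injEq,
      mem_insert_iff, mem_singleton_iff, Nat.cast_add, Nat.cast_ofNat]
    constructor
    · rintro ⟨⟨hk1, hk2⟩, ⟨hl1, hl2⟩, hp, hc⟩
      rcases lt_or_ge 2 k with hk | hk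
      · rcases lt_or_ge 2 l with hl | hl
        · refine Or.inl ⟨k - 2, l - 2, ⟨⟨by omega, by omega⟩, ⟨by omega, by omega⟩, by omega, ?_⟩,
            by omega, by omega⟩
          rwa [h.cross_fwd_fwd (by omega) (by omega) (by omega) (by omega), sub_add_cancel,
            sub_add_cancel]
        · obtain ⟨rfl, rfl⟩ := h.eq_of_cross_fwd_fwd hl1 hl hk1 hk2 (by omega)
            (hc.symm (fwd_ne h.red' _) (fwd_ne h.red' _))
          exact Or.inr (Or.inr ⟨rfl, rfl⟩)
      · exact Or.inr (Or.inl (h.eq_of_cross_fwd_fwd hk1 hk hl1 hl2 hp hc))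
    · rintro (⟨k, l, ⟨⟨hk1, hk2⟩, ⟨hl1, hl2⟩, hp, hc⟩, rfl, rfl⟩ | ⟨rfl, rfl⟩ | ⟨rfl, rfl⟩)
      · exact ⟨⟨by omega, by omega⟩, ⟨by omega, by omega⟩, by omega,
          (h.cross_fwd_fwd hk1 hk2 hl1 hl2).1 hc⟩
      · exact ⟨⟨by omega, by omega⟩, ⟨by omega, by omega⟩, by omega, h.cross_new⟩
      · exact ⟨⟨by omega, by omega⟩, ⟨by omega, by omega⟩, by omega,
          h.cross_new.symm (fwd_ne h.red' _) (fwd_ne h.red' _)⟩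
  rw [hU, ncard_union_eq ?_ ((finite_fwdSet g n).image _) (by simp), ncard_pair,
    ncard_image_of_injective]
  · rintro ⟨k, l⟩ ⟨k', l'⟩ e
    simpa using e
  · simp only [ne_eq, Prod.mk.injEq, not_and]
    omega
  · rw [Set.disjoint_left]
    rintro _ ⟨⟨k, l⟩, ⟨⟨hk1, hk2⟩, ⟨hl1, hl2⟩, -⟩, rfl⟩ hm
    simp only [mem_insert_iff, mem_singleton_iff, Prod.mk.injEq] at hm hk1 hk2 hl1 hl2
    omega

lemma ncard_bwdSet (h : Expansion g g' n len c) :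
    (bwdSet g' (n + 2)).ncard = (bwdSet g n).ncard := by
  have hlt := h.lt
  have hU : bwdSet g' (n + 2) =
      (fun p : ℤ × ℤ => (p.1 + 2, shiftB len p.2)) '' bwdSet g n := by
    ext ⟨k, l⟩
    simp only [bwdSet, mem_image, mem_ofPred_eq, Prod.exists, Prod.mk.injEq, Nat.cast_add,
      Nat.cast_ofNat]
    constructor
    · rintro ⟨⟨hk1, hk2⟩, ⟨hl1, hl2⟩, hp, hc⟩
      have hk : 2 < k := by
        by_contra! hk
        exact h.not_cross_fwd_bwd_of_left hk1 hk hp hc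
      have hl : l < len ∨ len + 2 ≤ l := by
        by_contra! hl
        exact h.not_cross_fwd_bwd_of_right hl.1 (by omega) hp hc
      obtain ⟨l, h1, h2, h3, rfl⟩ : ∃ l₀ : ℤ, 1 ≤ l₀ ∧ l₀ ≤ n ∧ (k - 2 - l₀) % 2 = 0 ∧
          shiftB len l₀ = l := by
        unfold shiftB
        rcases hl with hl | hl
        · exact ⟨l, hl1, by omega, by omega, if_pos hl⟩
        · refine ⟨l - 2, by have := h.two_le; omega, by omega, by omega, ?_⟩
          rw [if_neg (by omega), sub_add_cancel]
      refine ⟨k - 2, l, ⟨⟨by omega, by omega⟩, ⟨h1, h2⟩, h3, ?_⟩, by omega, rfl⟩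
      rwa [h.cross_fwd_bwd h3 (by omega) (by omega) h1 h2, sub_add_cancel]
    · rintro ⟨k, l, ⟨⟨hk1, hk2⟩, ⟨hl1, hl2⟩, hp, hc⟩, rfl, rfl⟩
      rw [h.cross_fwd_bwd hp hk1 hk2 hl1 hl2] at hc
      refine ⟨⟨by omega, by omega⟩, ?_, ?_, hc⟩ <;> unfold shiftB <;> split_ifs <;> omega
  rw [hU, ncard_image_of_injective]
  rintro ⟨k, l⟩ ⟨k', l'⟩ e
  simp only [Prod.mk.injEq, add_left_inj, shiftB] at e ⊢
  refine ⟨e.1, ?_⟩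
  have := e.2
  split_ifs at this <;> omega

lemma ncard_crossSet (h : Expansion g g' n len c) :
    (crossSet g' (n + 2) 1).ncard = (crossSet g n 1).ncard + 2 := by
  rw [AlmostSimple.ncard_crossSet h.red', AlmostSimple.ncard_crossSet h.red, h.ncard_fwdSet,
    h.ncard_bwdSet]
  ring

end Expansion

/-! ### From finite words to periodic words -/

/-- The bi-infinite periodic word determined by `w`. -/
def wordSeq (w : List Letter) (k : ℤ) : Letter := cget w (k % w.length).toNat

lemma cget_mod (w : List Letter) (k : ℕ) : cget w (k % w.length) = cget w k := by
  simp [cget]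

lemma wordSeq_natCast (w : List Letter) (k : ℕ) : wordSeq w k = cget w k := by
  rw [wordSeq, ← Int.natCast_mod, Int.toNat_natCast, cget_mod]

lemma wordSeq_add_length (w : List Letter) (k : ℤ) : wordSeq w (k + w.length) = wordSeq w k := by
  simp [wordSeq]

lemma wordSeq_ne {w : List Letter} (hw : CyclRed w) (k : ℤ) :
    wordSeq w k ≠ wordSeq w (k + 1) := by
  have hpos : 0 < (w.length : ℤ) := by exact_mod_cast List.length_pos_iff.2 hw.1
  obtain ⟨k, a, h0, h1, rfl⟩ := exists_residue hpos k
  lift k to ℕ using h0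
  rw [show (k : ℤ) + a * w.length + 1 = ((k + 1 : ℕ) : ℤ) + a * w.length by push_cast; ring,
    per_mul_of_per (wordSeq_add_length w), per_mul_of_per (wordSeq_add_length w),
    wordSeq_natCast, wordSeq_natCast]
  exact hw.2 k (by exact_mod_cast h1)

lemma seg_wordSeq (w : List Letter) : seg (wordSeq w) 0 w.length = w := by
  refine List.ext_getElem (by simp [seg]) fun k h1 h2 => ?_
  simp only [seg, List.getElem_map, List.getElem_range, zero_add, wordSeq_natCast, cget]
  rw [Nat.mod_eq_of_lt h2, List.getD_eq_getElem _ _ h2]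

lemma Cyc.of_shift {f g : ℤ → Letter} {n : ℕ} {i : ℤ} (h : ∀ j, g j = f (i + j))
    (hg : Cyc g n) : Cyc f n := by
  obtain rfl : f = fun j => g (j - i) := by
    funext j
    rw [h, add_sub_cancel]
  refine ⟨hg.pos, hg.even, fun k => ?_, fun k => ?_, fun d hd => hg.aper d fun j => ?_,
    fun a => ?_⟩
  · rw [← hg.per (k - i)]
    congr 1
    ring
  · have := hg.red (k - i)
    rwa [show k - i + 1 = k + 1 - i by ring] at this
  · have := hd (j + i)
    rwa [show j + i + d - i = j + d by ring, add_sub_cancel_right] at this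
  · obtain ⟨k, hk⟩ := hg.occ a
    exact ⟨k + i, by rwa [add_sub_cancel_right]⟩

lemma ncard_crossSet_of_shift {f g : ℤ → Letter} {i : ℤ} (h : ∀ j, g j = f (i + j)) (n : ℕ)
    (c : ℤ) : (crossSet f n (i + c)).ncard = (crossSet g n c).ncard := by
  obtain rfl : f = fun j => g (j - i) := by
    funext j
    rw [h, add_sub_cancel]
  have e : ∀ k l : ℤ, CrossAt (fun j => g (j - i)) (k + i) (l + i) ↔ CrossAt g k l := by
    intro k l
    have h1 : ∀ k, fwd (fun j => g (j - i)) (k + i) = fwd g k := fun k => by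
      funext j
      simp only [fwd]
      congr 1
      ring
    have h2 : ∀ k, bwd (fun j => g (j - i)) (k + i) = bwd g k := fun k => by
      funext j
      simp only [bwd]
      congr 1
      ring
    rw [CrossAt, CrossAt, h1, h1, h2]
  have hU : crossSet (fun j => g (j - i)) n (i + c) =
      (fun p : ℤ × ℤ => (p.1 + i, p.2 + i)) '' crossSet g n c := by
    ext ⟨k, l⟩
    simp only [crossSet, mem_image, mem_ofPred_eq, Prod.exists, Prod.mk.injEq]
    constructor
    · rintro ⟨h1, h2, h3, h4⟩
      refine ⟨k - i, l - i, ⟨by omega, by omega, by omega, ?_⟩, by omega, by omega⟩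
      rwa [← e, sub_add_cancel, sub_add_cancel]
    · rintro ⟨k, l, ⟨h1, h2, h3, h4⟩, rfl, rfl⟩
      exact ⟨by omega, by omega, by omega, (e k l).2 h4⟩
  rw [hU, ncard_image_of_injective]
  rintro ⟨k, l⟩ ⟨k', l'⟩ h
  simpa using h

lemma Iw_eq {w : List Letter} {g : ℤ → Letter} {i : ℤ} (h : ∀ j, g j = wordSeq w (i + j))
    (hg : Cyc g w.length) : Iw w = (((crossSet g w.length 1).ncard / 2 : ℕ) : ℤ) := by
  rw [Iw, Iγ_eq (hg.of_shift h) _ (i + 1), ncard_crossSet_of_shift h]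
  have := partialProd_add (f := wordSeq w) 0 w.length
  rw [zero_add, seg_wordSeq, partialProd_zero, one_mul] at this
  rw [this]
  exact act_phiM w hg.even

lemma expandAt_length {w : List Letter} {i : ℕ} (hi : i < w.length) :
    (expandAt w i).length = w.length + 2 := by
  simp only [expandAt, List.length_append, List.length_take, List.length_cons, List.length_nil,
    List.length_drop]
  omega

lemma cget_expandAt {w : List Letter} {i k : ℕ} (hi : i < w.length) (hk : k < w.length + 2) :
    cget (expandAt w i) k = if k < i + 2 then cget w k else cget w (k - 2) := by
  rw [cget, expandAt_length hi, Nat.mod_eq_of_lt hk, expandAt]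
  have ht : (w.take i).length = i := by simp [hi.le]
  rcases lt_or_ge k i with h1 | h1
  · rw [if_pos (by omega), List.append_assoc, List.getD_append _ _ _ _ (by omega), cget,
      Nat.mod_eq_of_lt (by omega), List.getD_eq_getElem?_getD, List.getD_eq_getElem?_getD,
      List.getElem?_take_of_lt h1]
  rw [List.append_assoc, List.getD_append_right _ _ _ _ (by omega), ht]
  obtain ⟨d, rfl⟩ := Nat.exists_eq_add_of_le h1
  rw [Nat.add_sub_cancel_left]
  match d with
  | 0 => simp
  | 1 => simp
  | d + 2 =>
    rw [if_neg (by omega), show i + (d + 2) - 2 = i + d by omega]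
    have : (i + d) % w.length = i + d := Nat.mod_eq_of_lt (by omega)
    simp [List.getD_eq_getElem?_getD, cget, this]

/-! ### Runs of a word -/

lemma card_erase_letter (c : Letter) : (({.x, .y, .z} : Finset Letter).erase c).card = 2 := by
  cases c <;> rfl

lemma mem_erase_letter {a c : Letter} :
    a ∈ ({.x, .y, .z} : Finset Letter).erase c ↔ a ≠ c := by
  cases a <;> simp

lemma pair_eq_erase {a b c : Letter} (hab : a ≠ b) (ha : a ≠ c) (hb : b ≠ c) :
    ({a, b} : Finset Letter) = ({.x, .y, .z} : Finset Letter).erase c := by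
  ext d
  rw [mem_erase_letter, Finset.mem_insert, Finset.mem_singleton]
  constructor
  · rintro (rfl | rfl) <;> assumption
  · exact letter_cases ha.symm hb.symm hab

lemma not_exists_card_two {a b c : Letter} (hab : a ≠ b) (ha : a ≠ c) (hb : b ≠ c)
    {T : Finset Letter} (hT : T.card = 2) (h1 : a ∈ T) (h2 : b ∈ T) (h3 : c ∈ T) : False := by
  have : ({a, b, c} : Finset Letter).card ≤ T.card := Finset.card_le_card (by
    simp [Finset.insert_subset_iff, h1, h2, h3])
  rw [Finset.card_eq_three.2 ⟨a, b, c, hab, ha, hb, rfl⟩] at this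
  omega

lemma wordSeq_sub_one {w : List Letter} {p : ℕ} (hp : p < w.length) (j : ℕ) :
    cget w (p + w.length - 1 + j) = wordSeq w (p + (j - 1)) := by
  rw [← wordSeq_natCast, ← wordSeq_add_length w (p + (j - 1))]
  congr 1
  omega

lemma runAt_of_omit {w : List Letter} (hw : CyclRed w) {p m : ℕ} {c : Letter} (hp : p < w.length)
    (hm : 2 ≤ m) (hmn : m < w.length) (hpre : wordSeq w (p - 1) = c)
    (hpost : wordSeq w (p + m) = c) (hrun : ∀ j : ℕ, j < m → wordSeq w (p + j) ≠ c) :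
    RunAt w p m := by
  have hne := wordSeq_ne hw p
  have h0 := hrun 0 (by omega)
  have h1 := hrun 1 (by omega)
  rw [Nat.cast_zero, add_zero] at h0
  rw [Nat.cast_one] at h1
  have e : ∀ j : ℕ, cget w (p + j) = wordSeq w (p + j) := fun j => by
    rw [← wordSeq_natCast, Nat.cast_add]
  refine ⟨hp, hm, hmn, ⟨_, card_erase_letter c, fun j hj => ?_⟩, ?_, ?_⟩
  · rw [e, mem_erase_letter]
    exact hrun j hj
  · rintro ⟨T, hT, h⟩
    have t0 := h 0 (by omega)
    have t1 := h 1 (by omega)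
    have t2 := h m (by omega)
    rw [e] at t0 t1 t2
    rw [Nat.cast_zero, add_zero] at t0
    rw [Nat.cast_one] at t1
    rw [hpost] at t2
    exact not_exists_card_two hne h0 h1 hT t0 t1 t2
  · rintro ⟨T, hT, h⟩
    have t0 := h 1 (by omega)
    have t1 := h 2 (by omega)
    have t2 := h 0 (by omega)
    rw [wordSeq_sub_one hp] at t0 t1 t2
    rw [Nat.cast_one, sub_self, add_zero] at t0
    rw [Nat.cast_ofNat, show (2 : ℤ) - 1 = 1 by rfl] at t1
    rw [Nat.cast_zero, zero_sub, ← sub_eq_add_neg, hpre] at t2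
    exact not_exists_card_two hne h0 h1 hT t0 t1 t2

lemma runType_eq {w : List Letter} (hw : CyclRed w) {p : ℕ} {c : Letter}
    (h0 : wordSeq w p ≠ c) (h1 : wordSeq w (p + 1) ≠ c) :
    runType w p = ({.x, .y, .z} : Finset Letter).erase c := by
  have hne := wordSeq_ne hw p
  have e : wordSeq w (p + 1) = cget w (p + 1) := by
    rw [← wordSeq_natCast, Nat.cast_add, Nat.cast_one]
  rw [e] at hne h1
  rw [wordSeq_natCast] at hne h0
  exact pair_eq_erase hne h0 h1

lemma exists_omit_of_runAt {w : List Letter} (hw : CyclRed w) {i len : ℕ} (h : RunAt w i len) :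
    ∃ c, wordSeq w (i - 1) = c ∧ wordSeq w (i + len) = c ∧
      ∀ j : ℕ, j < len → wordSeq w (i + j) ≠ c := by
  obtain ⟨hi, hlen, -, ⟨T, hT, hrun⟩, hpost, hpre⟩ := h
  have e : ∀ j : ℕ, cget w (i + j) = wordSeq w (i + j) := fun j => by
    rw [← wordSeq_natCast, Nat.cast_add]
  obtain ⟨c, h0, h1⟩ := exists_ne_ne (wordSeq w i) (wordSeq w (i + 1))
  have hne := wordSeq_ne hw i
  have hr : ∀ j : ℕ, j < len → wordSeq w (i + j) ≠ c := by
    intro j hj hc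
    have t0 := hrun 0 (by omega)
    have t1 := hrun 1 (by omega)
    have t2 := hrun j hj
    rw [e] at t0 t1 t2
    rw [Nat.cast_zero, add_zero] at t0
    rw [Nat.cast_one] at t1
    rw [hc] at t2
    exact not_exists_card_two hne h0.symm h1.symm hT t0 t1 t2
  refine ⟨c, ?_, ?_, hr⟩
  · by_contra hc
    refine hpre ⟨_, card_erase_letter c, fun j hj => ?_⟩
    rw [wordSeq_sub_one hi, mem_erase_letter]
    rcases j with _ | j
    · rwa [Nat.cast_zero, zero_sub, ← sub_eq_add_neg]
    · rw [Nat.cast_succ, add_sub_cancel_right]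
      exact hr j (by omega)
  · by_contra hc
    refine hpost ⟨_, card_erase_letter c, fun j hj => ?_⟩
    rw [e, mem_erase_letter]
    rcases (Nat.lt_succ_iff.1 hj).eq_or_lt with rfl | hj
    · exact hc
    · exact hr j hj

lemma exists_last {P : ℤ → Prop} {a b : ℤ} (hab : a ≤ b) (ha : P a) :
    ∃ s, a ≤ s ∧ s ≤ b ∧ P s ∧ ∀ j, s < j → j ≤ b → ¬ P j := by
  obtain ⟨s, ⟨h1, h2⟩, h3⟩ := Int.exists_greatest_of_bdd (P := fun s => s ≤ b ∧ P s)
    ⟨b, fun s h => h.1⟩ ⟨a, hab, ha⟩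
  exact ⟨s, h3 a ⟨hab, ha⟩, h1, h2, fun j hj hjb hP => by have := h3 j ⟨hjb, hP⟩; omega⟩

lemma exists_first {P : ℤ → Prop} {a b : ℤ} (hab : a ≤ b) (hb : P b) :
    ∃ s, a ≤ s ∧ s ≤ b ∧ P s ∧ ∀ j, a ≤ j → j < s → ¬ P j := by
  obtain ⟨s, ⟨h1, h2⟩, h3⟩ := Int.exists_least_of_bdd (P := fun s => a ≤ s ∧ P s)
    ⟨a, fun s h => h.1⟩ ⟨b, hab, hb⟩
  exact ⟨s, h1, h3 b ⟨hab, hb⟩, h2, fun j hj hjs hP => by have := h3 j ⟨hj, hP⟩; omega⟩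

lemma dvd_of_omit {w : List Letter} (hw : CyclRed w) {i len : ℕ}
    (h : DistinguishedRun w i len) {c : Letter} (hpre : wordSeq w (i - 1) = c)
    (hpost : wordSeq w (i + len) = c) (hrun : ∀ j : ℕ, j < len → wordSeq w (i + j) ≠ c)
    {q : ℤ} (hq : ∀ j : ℤ, 0 ≤ j → j < len → wordSeq w (i + (q + j)) ≠ c) :
    (w.length : ℤ) ∣ q := by
  obtain ⟨⟨hi, hlen, hlt, -⟩, huniq⟩ := h
  have hper := per_mul_of_per (wordSeq_add_length w)
  obtain ⟨q, a, h0, h1, rfl⟩ := exists_residue (N := w.length) (by omega) q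
  rcases h0.eq_or_lt with rfl | h0
  · simp
  replace hq : ∀ k : ℤ, q ≤ k → k < q + len → wordSeq w (i + k) ≠ c := fun k hk1 hk2 => by
    have := hq (k - q) (by omega) (by omega)
    rwa [show (i : ℤ) + (q + a * w.length + (k - q)) = i + k + a * w.length by ring, hper] at this
  exfalso
  have hq1 : (len : ℤ) < q := by
    by_contra! hle
    exact hq len hle (by omega) hpost
  have hlast : wordSeq w (i + (w.length - 1)) = c := by
    rw [← hpre, ← wordSeq_add_length w (i - 1)]
    congr 1
    ring
  have hq2 : q + len ≤ w.length - 1 := by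
    by_contra! hle
    exact hq _ (by omega) hle hlast
  obtain ⟨s, hs1, hs2, hs3, hs4⟩ := exists_last (P := fun k => wordSeq w (i + k) = c)
    (a := len) (b := q - 1) (by omega) hpost
  obtain ⟨e, he1, he2, he3, he4⟩ := exists_first (P := fun k => wordSeq w (i + k) = c)
    (a := q + len) (b := w.length - 1) hq2 hlast
  obtain ⟨p, b, hp0, hp1, hp⟩ := exists_residue (N := w.length) (by omega) (i + (s + 1))
  lift p to ℕ using hp0
  have hseq : ∀ k, wordSeq w (p + k) = wordSeq w (i + (s + 1 + k)) := fun k => by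
    rw [← hper (p + k) b]
    congr 1
    linarith
  obtain ⟨m, hm⟩ := Int.eq_ofNat_of_zero_le (a := e - (s + 1)) (by omega)
  have hrun' : ∀ j : ℕ, j < m → wordSeq w (p + j) ≠ c := fun j hj => by
    rw [hseq]
    rcases lt_or_ge (s + 1 + j) q with hj1 | hj1
    · exact hs4 _ (by omega) (by omega)
    rcases lt_or_ge (s + 1 + j) (q + len) with hj2 | hj2
    · exact hq _ hj1 hj2
    · exact he4 _ hj2 (by omega)
  have hr : RunAt w p m := by
    refine runAt_of_omit hw (by omega) (by omega) (by omega) ?_ ?_ hrun'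
    · rw [sub_eq_add_neg, hseq, add_neg_cancel_right, hs3]
    · rw [hseq, ← hm, add_sub_cancel, he3]
  have ht : runType w p = runType w i := by
    have a0 := hrun 0 (by omega)
    have a1 := hrun 1 (by omega)
    have b0 := hrun' 0 (by omega)
    have b1 := hrun' 1 (by omega)
    rw [Nat.cast_zero, add_zero] at a0 b0
    rw [Nat.cast_one] at a1 b1
    rw [runType_eq hw a0 a1, runType_eq hw b0 b1]
  have hpi : p ≠ i := by
    rintro rfl
    have hb : s + 1 = b * w.length := by linarith
    have : (w.length : ℤ) ∣ s + 1 := ⟨b, by rw [hb, mul_comm]⟩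
    have := Int.le_of_dvd (by omega) this
    omega
  have := huniq p m hr ht hpi
  omega

lemma exists_expansion {w : List Letter} (hw : InG w) {i len : ℕ}
    (h : DistinguishedRun w i len) :
    ∃ c, Expansion (fun j => wordSeq w (i + j)) (fun j => wordSeq (expandAt w i) (i + j))
      w.length len c := by
  obtain ⟨hred, -, heven, -⟩ := hw
  obtain ⟨c, hpre, hpost, hrun⟩ := exists_omit_of_runAt hred h.1
  have hi := h.1.1
  have hl := expandAt_length hi
  have hlen := h.1.2.1
  refine ⟨c, even_iff_two_dvd.2 heven, hlen, h.1.2.2.1, fun k => ?_, fun k => ?_, fun k => ?_,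
    fun j h0 h1 => ?_, fun j h0 h1 => ?_, fun j h0 h1 => ?_, ?_, hpost,
    fun q hq => dvd_of_omit hred h hpre hpost hrun hq⟩
  · rw [← add_assoc, wordSeq_add_length]
  · have := wordSeq_add_length (expandAt w i) (i + k)
    rwa [hl, Nat.cast_add, Nat.cast_ofNat, add_assoc] at this
  · rw [← add_assoc]
    exact wordSeq_ne hred _
  · lift j to ℕ using h0
    rw [← Nat.cast_add, wordSeq_natCast, wordSeq_natCast, cget_expandAt hi (by omega),
      if_pos (by omega)]
  · lift j to ℕ using h0
    rcases lt_or_ge (i + j) w.length with hj | hj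
    · rw [show (i : ℤ) + (j + 2) = ((i + j + 2 : ℕ) : ℤ) by push_cast; ring, ← Nat.cast_add,
        wordSeq_natCast, wordSeq_natCast, cget_expandAt hi (by omega), if_neg (by omega),
        Nat.add_sub_cancel]
    · obtain ⟨k, hk⟩ := Nat.exists_eq_add_of_le hj
      rw [show (i : ℤ) + (j + 2) = (k : ℤ) + ((expandAt w i).length : ℕ) by rw [hl]; omega,
        show (i : ℤ) + j = (k : ℤ) + w.length by omega, wordSeq_add_length, wordSeq_add_length,
        wordSeq_natCast, wordSeq_natCast, cget_expandAt hi (by omega), if_pos (by omega)]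
  · lift j to ℕ using h0
    exact hrun j (by exact_mod_cast h1)
  · rw [← sub_eq_add_neg, hpre]

lemma Iw_expandAt {w : List Letter} (hw : InG w) {i len : ℕ} (h : DistinguishedRun w i len) :
    Iw (expandAt w i) = Iw w + 1 := by
  obtain ⟨c, he⟩ := exists_expansion hw h
  have hl := expandAt_length h.1.1
  have hc := he.cyc'
  rw [← hl] at hc
  rw [Iw_eq (fun _ => rfl) hc, Iw_eq (fun _ => rfl) he.cyc, hl, he.ncard_crossSet,
    Nat.add_div_right _ two_pos, Nat.cast_succ]

end AlmostSimple

theorem almost_simple_geodesics_stmt5 (w : List Letter) (hw : InG w)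
    (i len : ℕ) (hd : DistinguishedRun w i len) :
    Iw (expandAt w i) = Iw w + 1 :=
  AlmostSimple.Iw_expandAt hw hd
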